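/- arXiv:1406.5274 — 3 statements merged into one kernel-verified Lean document; each statement's English description precedes it below -/
import Mathlib

section
/- Let n ≥ 2 and α ∈ (0,1). Let Φ : ℝⁿ → ℝ be harmonic on ℝⁿ \ {0}, i.e., twice continuously differentiable with ΔΦ = 0 on ℝⁿ \ {0}. Assume that sup{ |x|^{1−α} |∇Φ(x)| : 0 < |x| ≤ 1 } < ∞. Then Φ extends to a harmonic function on all of ℝⁿ: there exists Ψ : ℝⁿ → ℝ harmonic on ℝⁿ such that Ψ(x) = Φ(x) for all x ≠ 0. -/
open MeasureTheory Set Metric Filter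

noncomputable section

abbrev En (n : ℕ) := EuclideanSpace ℝ (Fin n)

/-- the `i`-th standard basis vector of `ℝⁿ`. -/
def eb (n : ℕ) (i : Fin n) : En n := EuclideanSpace.single i 1

/-- the Laplacian `Δf`, computed as the sum of the second derivatives in the
coordinate directions. -/
def vlap {n : ℕ} {F : Type*} [NormedAddCommGroup F] [NormedSpace ℝ F]
    (f : En n → F) (x : En n) : F :=
  ∑ i, fderiv ℝ (fun y => fderiv ℝ f y (eb n i)) x (eb n i)

/-- the divergence `div v = Σⱼ ∂vʲ/∂xⱼ` of a vector field. -/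
def vdiv {n : ℕ} (v : En n → En n) (x : En n) : ℝ :=
  ∑ i, fderiv ℝ v x (eb n i) i

/-- the index of the last coordinate of `ℝⁿ`. -/
def lastIdx (n : ℕ) (hn : 2 ≤ n) : Fin n := ⟨n - 1, by omega⟩

/-- the last coordinate `xₙ` of a point of `ℝⁿ`. -/
def xlast (n : ℕ) (hn : 2 ≤ n) (x : En n) : ℝ := x (lastIdx n hn)

/-- the open upper half space `ℝⁿ₊ = {x : xₙ > 0}`. -/
def openHalf (n : ℕ) (hn : 2 ≤ n) : Set (En n) := {x : En n | 0 < xlast n hn x}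

/-- the closed upper half space `{x : xₙ ≥ 0}`. -/
def closedHalf (n : ℕ) (hn : 2 ≤ n) : Set (En n) := {x : En n | 0 ≤ xlast n hn x}


/-- A function whose derivative is `O(‖x‖ ^ (α - 1))` near the origin, with `α > 0`, is locally
bounded, including near the origin. -/
lemma exists_abs_le_of_norm_fderiv_le {E : Type*} [NormedAddCommGroup E] [NormedSpace ℝ E]
    [FiniteDimensional ℝ E] {Φ : E → ℝ} {α C : ℝ} (hα : 0 < α)
    (hd : ∀ x ≠ 0, DifferentiableAt ℝ Φ x)
    (hC : ∀ x ≠ 0, ‖x‖ ≤ 1 → ‖fderiv ℝ Φ x‖ ≤ C * ‖x‖ ^ (α - 1)) (R : ℝ) :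
    ∃ M, ∀ x, ‖x‖ ≤ R → |Φ x| ≤ M := by
  have hcomp : IsCompact (closedBall (0 : E) (max R 1) \ ball 0 1) :=
    (isCompact_closedBall 0 _).diff isOpen_ball
  obtain ⟨M, hM⟩ := hcomp.exists_bound_of_continuousOn (f := Φ) fun x hx =>
    (hd x (by rintro rfl; simp at hx)).continuousAt.continuousWithinAt
  have hM' : ∀ x, 1 ≤ ‖x‖ → ‖x‖ ≤ max R 1 → |Φ x| ≤ M := fun x h1 h2 =>
    hM x (by simpa using ⟨le_max_iff.1 h2, h1⟩)
  have hnear : ∀ x ≠ 0, ‖x‖ ≤ 1 → |Φ x| ≤ M + C / α := by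
    intro x hx hx1
    have hr : 0 < ‖x‖ := norm_pos_iff.2 hx
    set u : E := ‖x‖⁻¹ • x with hu
    have hu1 : ‖u‖ = 1 := by rw [hu, norm_smul, norm_inv, norm_norm, inv_mul_cancel₀ hr.ne']
    have hu0 : u ≠ 0 := by rintro h; simp [h] at hu1
    have hC0 : 0 ≤ C := by
      have := (norm_nonneg _).trans (hC u hu0 hu1.le)
      simpa [hu1] using this
    have hpos : ∀ s ∈ Icc 0 (1 - ‖x‖), 0 < 1 - s := fun s hs => by linarith [hs.2]
    have hder : ∀ s ∈ Icc 0 (1 - ‖x‖), HasDerivAt (fun s : ℝ => Φ ((1 - s) • u))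
        (fderiv ℝ Φ ((1 - s) • u) (-u)) s := by
      intro s hs
      have h1 : HasDerivAt (fun s : ℝ => (1 - s) • u) (-u) s := by
        simpa using ((hasDerivAt_id s).const_sub 1).smul_const u
      exact (hd _ (smul_ne_zero (hpos s hs).ne' hu0)).hasFDerivAt.comp_hasDerivAt s h1
    have hB : ∀ s ∈ Icc 0 (1 - ‖x‖), HasDerivAt
        (fun s : ℝ => M + C / α * (1 - (1 - s) ^ α)) (C * (1 - s) ^ (α - 1)) s := by
      intro s hs
      have := ((((hasDerivAt_id s).const_sub 1).rpow_const (p := α)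
        (Or.inl (hpos s hs).ne')).const_sub 1).const_mul (C / α)
      refine (this.const_add M).congr_deriv ?_
      simp only [id]
      field_simp
    have key := image_norm_le_of_norm_deriv_right_le_deriv_boundary'
      (f := fun s : ℝ => Φ ((1 - s) • u)) (a := 0) (b := 1 - ‖x‖)
      (fun s hs => (hder s hs).continuousAt.continuousWithinAt)
      (fun s hs => (hder s ⟨hs.1, hs.2.le⟩).hasDerivWithinAt)
      (B := fun s : ℝ => M + C / α * (1 - (1 - s) ^ α))
      (by simpa using hM' u hu1.ge (by simp [hu1]))
      (fun s hs => (hB s hs).continuousAt.continuousWithinAt)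
      (fun s hs => (hB s ⟨hs.1, hs.2.le⟩).hasDerivWithinAt)
      (fun s hs => by
        have hs' : s ∈ Icc 0 (1 - ‖x‖) := ⟨hs.1, hs.2.le⟩
        have hn : ‖(1 - s) • u‖ = 1 - s := by
          rw [norm_smul, hu1, mul_one, Real.norm_of_nonneg (hpos s hs').le]
        calc _ ≤ ‖fderiv ℝ Φ ((1 - s) • u)‖ * ‖-u‖ := ContinuousLinearMap.le_opNorm _ _
          _ ≤ C * (1 - s) ^ (α - 1) := by
            rw [norm_neg, hu1, mul_one]
            have := hC _ (smul_ne_zero (hpos s hs').ne' hu0) (by rw [hn]; linarith [hs.1])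
            rwa [hn] at this)
      (right_mem_Icc.2 (by linarith))
    have hx' : ‖x‖ • u = x := by rw [hu, smul_inv_smul₀ hr.ne']
    simp only [sub_sub_cancel, hx', Real.norm_eq_abs] at key
    refine key.trans ?_
    have : 0 ≤ ‖x‖ ^ α := by positivity
    have : C / α * (1 - ‖x‖ ^ α) ≤ C / α * 1 := by gcongr; linarith
    linarith
  refine ⟨max |Φ 0| (max M (M + C / α)), fun x hx => ?_⟩
  by_cases h0 : x = 0
  · simp [h0]
  rcases le_total ‖x‖ 1 with h1 | h1
  · exact (hnear x h0 h1).trans (by simp)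
  · exact (hM' x h1 (hx.trans (le_max_left _ _))).trans (by simp)

lemma locallyIntegrable_of_forall_abs_le {E : Type*} [NormedAddCommGroup E] [NormedSpace ℝ E]
    [FiniteDimensional ℝ E] [MeasurableSpace E] [BorelSpace E] {μ : Measure E}
    [IsLocallyFiniteMeasure μ] {Φ : E → ℝ} (hm : Measurable Φ)
    (hb : ∀ R : ℝ, ∃ M, ∀ x, ‖x‖ ≤ R → |Φ x| ≤ M) : LocallyIntegrable Φ μ := by
  have : ProperSpace E := FiniteDimensional.proper_real E
  intro x
  obtain ⟨M, hM⟩ := hb (‖x‖ + 1)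
  refine ⟨closedBall x 1, closedBall_mem_nhds x one_pos, ?_⟩
  refine Measure.integrableOn_of_bounded (M := M) measure_closedBall_lt_top.ne
    hm.aestronglyMeasurable ?_
  refine (ae_restrict_iff' measurableSet_closedBall).2 (ae_of_all _ fun y hy => hM y ?_)
  rw [mem_closedBall, dist_eq_norm] at hy
  linarith [norm_le_norm_add_norm_sub' y x]

lemma integral_fderiv_apply_eq_zero {E : Type*} [NormedAddCommGroup E] [NormedSpace ℝ E]
    [FiniteDimensional ℝ E] [MeasurableSpace E] [BorelSpace E] {μ : Measure E}
    [μ.IsAddHaarMeasure] {V : E → ℝ} (hV : ContDiff ℝ 1 V) (hc : HasCompactSupport V) (v : E) :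
    ∫ y, fderiv ℝ V y v ∂μ = 0 := by
  have hint : Integrable (fun y => fderiv ℝ V y v) μ :=
    ((hV.continuous_fderiv (by simp)).clm_apply continuous_const).integrable_of_hasCompactSupport
      (hc.fderiv_apply ℝ v)
  have := integral_mul_fderiv_eq_neg_fderiv_mul_of_integrable (μ := μ) (f := fun _ => (1 : ℝ))
    (g := V) (v := v) (by simp) (by simpa using hint)
    (by simpa using hV.continuous.integrable_of_hasCompactSupport hc)
    (fun x _ => differentiableAt_const _) (fun x _ => hV.differentiable (by simp) x)
  simpa using this

lemma ContDiff.continuous_vlap {n : ℕ} {f : En n → ℝ} (hf : ContDiff ℝ 2 f) :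
    Continuous (vlap f) := by
  unfold vlap
  refine continuous_finsetSum _ fun i _ => ?_
  have h1 : ContDiff ℝ 1 fun y => fderiv ℝ f y (eb n i) :=
    (hf.fderiv_right (m := 1) (by norm_num)).clm_apply contDiff_const
  exact (h1.continuous_fderiv (by simp)).clm_apply continuous_const

lemma HasCompactSupport.vlap {n : ℕ} {f : En n → ℝ} (hf : HasCompactSupport f) :
    HasCompactSupport (vlap f) := by
  refine hf.mono' fun x hx => ?_
  by_contra h
  refine hx ?_
  have h0 : f =ᶠ[nhds x] 0 := notMem_tsupport_iff_eventuallyEq.1 h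
  have h1 : fderiv ℝ f =ᶠ[nhds x] 0 := by simpa using h0.fderiv (𝕜 := ℝ)
  have h2 (i : Fin n) : (fun y => fderiv ℝ f y (eb n i)) =ᶠ[nhds x] fun _ => 0 :=
    h1.mono fun y hy => by simp [hy]
  simp only [_root_.vlap, (h2 _).fderiv_eq]
  simp

/-- Green's identity for a function harmonic off the origin, with a cutoff vanishing near it. -/
lemma integral_cutoff_mul_vlap {n : ℕ} {Φ η φ : En n → ℝ}
    (hreg : ContDiffOn ℝ 2 Φ {(0 : En n)}ᶜ) (hharm : ∀ x : En n, x ≠ 0 → vlap Φ x = 0)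
    (hη : ContDiff ℝ 1 η) (hη0 : η =ᶠ[nhds 0] 0) (hφ : ContDiff ℝ 2 φ)
    (hc : HasCompactSupport φ) :
    ∫ y, η y * (Φ y * vlap φ y) = ∫ y, ∑ i, fderiv ℝ η y (eb n i) *
      (fderiv ℝ Φ y (eb n i) * φ y - Φ y * fderiv ℝ φ y (eb n i)) := by
  have hΦ : ∀ y ≠ 0, ContDiffAt ℝ 2 Φ y := fun y hy =>
    hreg.contDiffAt (isOpen_compl_singleton.mem_nhds hy)
  have hDΦ : ∀ i, ∀ y ≠ 0, ContDiffAt ℝ 1 (fun y => fderiv ℝ Φ y (eb n i)) y := fun i y hy =>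
    ((hΦ y hy).fderiv_right (m := 1) (by norm_num)).clm_apply contDiffAt_const
  have hDφ : ∀ i, ContDiff ℝ 1 (fun y => fderiv ℝ φ y (eb n i)) := fun i =>
    (hφ.fderiv_right (m := 1) (by norm_num)).clm_apply contDiff_const
  set V : Fin n → En n → ℝ := fun i y =>
    η y * (Φ y * fderiv ℝ φ y (eb n i) - fderiv ℝ Φ y (eb n i) * φ y) with hV
  have hV0 : ∀ i, V i =ᶠ[nhds 0] fun _ => 0 := fun i => hη0.mono fun y hy => by simp [hV, hy]
  have hVc : ∀ i, ContDiff ℝ 1 (V i) := by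
    refine fun i => contDiff_iff_contDiffAt.2 fun y => ?_
    by_cases hy : y = 0
    · exact hy ▸ contDiffAt_const.congr_of_eventuallyEq (hV0 i)
    · exact hη.contDiffAt.mul ((((hΦ y hy).of_le (by norm_num)).mul (hDφ i).contDiffAt).sub
        ((hDΦ i y hy).mul (hφ.of_le (by norm_num)).contDiffAt))
  have hVs : ∀ i, HasCompactSupport (V i) := fun i =>
    ((hc.fderiv_apply ℝ (eb n i)).mul_left.sub hc.mul_left).mul_left
  have hpt : ∀ y, η y * (Φ y * vlap φ y) - ∑ i, fderiv ℝ η y (eb n i) *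
      (fderiv ℝ Φ y (eb n i) * φ y - Φ y * fderiv ℝ φ y (eb n i))
      = ∑ i, fderiv ℝ (V i) y (eb n i) := by
    intro y
    by_cases hy : y = 0
    · subst hy
      have h1 : fderiv ℝ η 0 = 0 := by rw [hη0.fderiv_eq]; simp
      simp [(hV0 _).fderiv_eq, h1, hη0.eq_of_nhds]
    · have hd : ∀ i, fderiv ℝ (V i) y (eb n i) =
          η y * (Φ y * fderiv ℝ (fun y => fderiv ℝ φ y (eb n i)) y (eb n i))
          - η y * (φ y * fderiv ℝ (fun y => fderiv ℝ Φ y (eb n i)) y (eb n i))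
          - fderiv ℝ η y (eb n i) *
            (fderiv ℝ Φ y (eb n i) * φ y - Φ y * fderiv ℝ φ y (eb n i)) := by
        intro i
        have e1 := (hη.differentiable (by simp) y).hasFDerivAt
        have e2 := ((hΦ y hy).differentiableAt (by simp)).hasFDerivAt
        have e3 := ((hDφ i).differentiable (by simp) y).hasFDerivAt
        have e4 := ((hDΦ i y hy).differentiableAt (by simp)).hasFDerivAt
        have e5 := (hφ.differentiable (by simp) y).hasFDerivAt
        have e := (e1.mul ((e2.mul e3).sub (e4.mul e5))).fderiv
        change fderiv ℝ (V i) y = _ at e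
        rw [e]
        simp
        ring
      have h0 := hharm y hy
      simp only [vlap] at h0 ⊢
      simp only [hd, Finset.sum_sub_distrib, ← Finset.mul_sum, h0]
      ring
  have hint : Integrable fun y => η y * (Φ y * vlap φ y) := by
    refine Continuous.integrable_of_hasCompactSupport ?_ hc.vlap.mul_left.mul_left
    refine continuous_iff_continuousAt.2 fun y => ?_
    by_cases hy : y = 0
    · subst hy
      exact (continuousAt_const (y := (0 : ℝ))).congr (hη0.mono fun y hy => by simp [hy])
    · exact hη.continuous.continuousAt.mul
        ((hΦ y hy).continuousAt.mul hφ.continuous_vlap.continuousAt)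
  have hintV : ∀ i, Integrable fun y => fderiv ℝ (V i) y (eb n i) := fun i =>
    (((hVc i).continuous_fderiv (by simp)).clm_apply
      continuous_const).integrable_of_hasCompactSupport ((hVs i).fderiv_apply ℝ _)
  have hint' : Integrable fun y => ∑ i, fderiv ℝ η y (eb n i) *
      (fderiv ℝ Φ y (eb n i) * φ y - Φ y * fderiv ℝ φ y (eb n i)) := by
    refine (hint.sub (integrable_finsetSum Finset.univ fun i _ => hintV i)).congr
      (ae_of_all _ fun y => ?_)
    simp [← hpt]
  rw [← sub_eq_zero, ← integral_sub hint hint']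
  simp only [hpt]
  rw [integral_finsetSum _ fun i _ => hintV i]
  exact Finset.sum_eq_zero fun i _ => integral_fderiv_apply_eq_zero (hVc i) (hVs i) _

/-- Smooth cutoffs that vanish near the origin and equal `1` off the ball of radius `2 * ε`, with
gradient of size `O(1 / ε)` and supported in the annulus `ε ≤ ‖y‖ ≤ 2 * ε`. -/
lemma exists_cutoff (E : Type*) [NormedAddCommGroup E] [InnerProductSpace ℝ E]
    [FiniteDimensional ℝ E] :
    ∃ L : ℝ, ∀ ε > 0, ∃ η : E → ℝ, ContDiff ℝ 1 η ∧ η =ᶠ[nhds 0] 0 ∧ (∀ y, |η y| ≤ 1) ∧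
      (∀ y, 2 * ε ≤ ‖y‖ → η y = 1) ∧ (∀ y, ‖y‖ < ε → fderiv ℝ η y = 0) ∧
      (∀ y, 2 * ε < ‖y‖ → fderiv ℝ η y = 0) ∧ ∀ y, ‖fderiv ℝ η y‖ ≤ L / ε := by
  let f : ContDiffBump (0 : E) := ⟨1, 2, one_pos, one_lt_two⟩
  have hf : ContDiff ℝ 1 f := f.contDiff
  obtain ⟨L, hL⟩ := (hf.continuous_fderiv (by simp)).bounded_above_of_compact_support
    (f.hasCompactSupport.fderiv ℝ)
  refine ⟨L, fun ε hε => ?_⟩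
  have hn : ∀ y : E, ‖ε⁻¹ • y‖ = ‖y‖ / ε := fun y => by
    rw [norm_smul, norm_inv, Real.norm_of_nonneg hε.le, inv_mul_eq_div]
  set η : E → ℝ := fun y => 1 - f (ε⁻¹ • y) with hη
  have hlt : ∀ y, ‖y‖ < ε → η =ᶠ[nhds y] 0 := fun y hy => by
    filter_upwards [(isOpen_lt continuous_norm continuous_const).mem_nhds hy] with z hz
    have : f (ε⁻¹ • z) = 1 := f.one_of_mem_closedBall (by
      rw [mem_closedBall_zero_iff, hn, div_le_one hε]
      exact le_of_lt hz)
    simp [hη, this]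
  have hge : ∀ y, 2 * ε ≤ ‖y‖ → η y = 1 := fun y hy => by
    have : f (ε⁻¹ • y) = 0 := f.zero_of_le_dist (by
      rw [dist_zero_right, hn, le_div_iff₀ hε]; exact hy)
    simp [hη, this]
  refine ⟨η, contDiff_const.sub (hf.comp (contDiff_const_smul _)), hlt 0 (by simpa), fun y => ?_,
    hge, fun y hy => by rw [(hlt y hy).fderiv_eq]; simp, fun y hy => ?_, fun y => ?_⟩
  · have h1 := f.nonneg (x := ε⁻¹ • y)
    have h2 := f.le_one (x := ε⁻¹ • y)
    rw [abs_le]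
    constructor <;> simp only [hη] <;> linarith
  · have : η =ᶠ[nhds y] fun _ => 1 := by
      filter_upwards [(isOpen_lt continuous_const continuous_norm).mem_nhds hy] with z hz
      exact hge z (le_of_lt hz)
    rw [this.fderiv_eq]; simp
  · have h1 : HasFDerivAt (fun y : E => ε⁻¹ • y) (ε⁻¹ • ContinuousLinearMap.id ℝ E) y :=
      (hasFDerivAt_id y).const_smul ε⁻¹
    have h2 := ((hf.differentiable (by simp) _).hasFDerivAt.comp y h1).const_sub 1
    have h3 : fderiv ℝ η y = -(ε⁻¹ • fderiv ℝ f (ε⁻¹ • y)) := by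
      refine h2.fderiv.trans ?_
      ext v; simp
    rw [h3, norm_neg, norm_smul, norm_inv, Real.norm_of_nonneg hε.le, inv_mul_eq_div]
    gcongr
    exact hL _

/-- A function harmonic off the origin whose gradient is `O(‖x‖ ^ (α - 1))` there, `α > 0`, is
weakly harmonic across the origin. -/
lemma integral_mul_vlap_eq_zero {n : ℕ} (hn : 2 ≤ n) {Φ φ : En n → ℝ} {α C : ℝ} (hα : 0 < α)
    (hα1 : α < 1) (hreg : ContDiffOn ℝ 2 Φ {(0 : En n)}ᶜ)
    (hharm : ∀ x : En n, x ≠ 0 → vlap Φ x = 0)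
    (hC : ∀ x : En n, x ≠ 0 → ‖x‖ ≤ 1 → ‖fderiv ℝ Φ x‖ ≤ C * ‖x‖ ^ (α - 1))
    (hb : ∀ R : ℝ, ∃ M, ∀ x, ‖x‖ ≤ R → |Φ x| ≤ M)
    (hφ : ContDiff ℝ 2 φ) (hc : HasCompactSupport φ) : ∫ y, Φ y * vlap φ y = 0 := by
  have : Nonempty (Fin n) := ⟨⟨0, by omega⟩⟩
  obtain ⟨L, hL⟩ := exists_cutoff (En n)
  obtain ⟨M, hM⟩ := hb 1
  obtain ⟨S, hS⟩ := hφ.continuous.bounded_above_of_compact_support hc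
  obtain ⟨S', hS'⟩ := (hφ.continuous_fderiv (by simp)).bounded_above_of_compact_support
    (hc.fderiv ℝ)
  have hloc : LocallyIntegrable Φ := locallyIntegrable_of_forall_abs_le
    (measurable_of_continuousOn_compl_singleton 0 hreg.continuousOn) hb
  have hint : Integrable fun y => Φ y * vlap φ y :=
    hloc.integrable_smul_right_of_hasCompactSupport hφ.continuous_vlap hc.vlap
  have hS0 : 0 ≤ S := (norm_nonneg _).trans (hS 0)
  have hS'0 : 0 ≤ S' := (norm_nonneg _).trans (hS' 0)
  have hM0 : 0 ≤ M := (abs_nonneg _).trans (hM 0 (by simp))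
  have heb : ∀ i, ‖eb n i‖ = 1 := fun i => by simp [eb]
  have hC0 : 0 ≤ C := by
    have i : Fin n := Classical.arbitrary _
    have h1 := hC (eb n i) (norm_ne_zero_iff.1 (by simp [heb])) (heb i).le
    rw [heb, Real.one_rpow, mul_one] at h1
    exact (norm_nonneg _).trans h1
  set v := (volume : Measure (En n)).real (ball 0 1)
  set K := n * (L * (C * S + M * S')) * (4 * v)
  choose! η hη1 hη0 hηle hηone hηlt hηgt hηD using hL
  have hbound : ∀ ε ∈ Ioc (0 : ℝ) (1 / 2),
      ‖∫ y, η ε y * (Φ y * vlap φ y)‖ ≤ K * ε ^ α := by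
    rintro ε ⟨hε, hε2⟩
    rw [integral_cutoff_mul_vlap hreg hharm (hη1 ε hε) (hη0 ε hε) hφ hc]
    have hL0 : 0 ≤ L / ε := (norm_nonneg _).trans (hηD ε hε 0)
    have hε1 : 1 ≤ ε ^ (α - 1) :=
      Real.one_le_rpow_of_pos_of_le_one_of_nonpos hε (by linarith) (by linarith)
    rw [← setIntegral_eq_integral_of_forall_compl_eq_zero (s := closedBall 0 (2 * ε))]
    · refine (norm_setIntegral_le_of_norm_le_const (C := n * (L / ε * (ε ^ (α - 1) *
        (C * S + M * S')))) measure_closedBall_lt_top fun y hy => ?_).trans ?_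
      · rw [mem_closedBall_zero_iff] at hy
        refine (norm_sum_le _ _).trans ((Finset.sum_le_card_nsmul _ _
          (L / ε * (ε ^ (α - 1) * (C * S + M * S'))) fun i _ => ?_).trans
          (by simp))
        by_cases hyε : ‖y‖ < ε
        · rw [hηlt ε hε y hyε]
          simp only [zero_apply, zero_mul, norm_zero]
          positivity
        push Not at hyε
        have hop : ∀ T : En n →L[ℝ] ℝ, ‖T (eb n i)‖ ≤ ‖T‖ := fun T => by
          simpa [heb] using T.le_opNorm (eb n i)
        have hy0 : y ≠ 0 := norm_pos_iff.1 (hε.trans_le hyε)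
        have hy1 : ‖y‖ ≤ 1 := by linarith
        have hΦ : ‖fderiv ℝ Φ y (eb n i)‖ ≤ C * ε ^ (α - 1) := by
          refine (hop _).trans ((hC y hy0 hy1).trans
            (mul_le_mul_of_nonneg_left ?_ hC0))
          exact Real.rpow_le_rpow_of_nonpos hε hyε (by linarith)
        have hΦ' : ‖Φ y‖ ≤ M * ε ^ (α - 1) :=
          (hM y hy1).trans (le_mul_of_one_le_right hM0 hε1)
        calc _ ≤ L / ε * (‖fderiv ℝ Φ y (eb n i)‖ * ‖φ y‖ +
              ‖Φ y‖ * ‖fderiv ℝ φ y (eb n i)‖) := by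
              rw [norm_mul]
              refine mul_le_mul ((hop _).trans (hηD ε hε y)) ?_ (norm_nonneg _) hL0
              refine (norm_sub_le _ _).trans ?_
              rw [norm_mul, norm_mul]
          _ ≤ L / ε * (C * ε ^ (α - 1) * S + M * ε ^ (α - 1) * S') := by
              gcongr
              · exact hS y
              · exact (hop _).trans (hS' y)
          _ = _ := by ring
      · rw [Measure.addHaar_real_closedBall _ _ (by positivity), finrank_euclideanSpace_fin]
        have h1 : (2 * ε) ^ n ≤ (2 * ε) ^ 2 :=
          pow_le_pow_of_le_one (by positivity) (by linarith) hn
        calc _ ≤ n * (L / ε * (ε ^ (α - 1) * (C * S + M * S'))) * ((2 * ε) ^ 2 * v) := by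
              gcongr
          _ = K * ε ^ α := by
              rw [Real.rpow_sub_one hε.ne']
              simp only [K]
              field_simp
              ring
    · intro y hy
      rw [mem_closedBall_zero_iff, not_le] at hy
      simp [hηgt ε hε y hy]
  set ε : ℕ → ℝ := fun k => 1 / ((k : ℝ) + 1) with hεdef
  have hεpos : ∀ k, 0 < ε k := fun k => by simp only [hεdef]; positivity
  have hεlim : Tendsto ε atTop (nhds 0) := tendsto_one_div_add_atTop_nhds_zero_nat
  have hlim : Tendsto (fun k => ∫ y, η (ε k) y * (Φ y * vlap φ y)) atTop
      (nhds (∫ y, Φ y * vlap φ y)) := by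
    refine tendsto_integral_of_dominated_convergence (fun y => ‖Φ y * vlap φ y‖)
      (fun k => (hη1 _ (hεpos k)).continuous.aestronglyMeasurable.mul hint.1) hint.norm
      (fun k => ae_of_all _ fun y => ?_) ?_
    · rw [norm_mul]
      exact mul_le_of_le_one_left (norm_nonneg _) (hηle _ (hεpos k) y)
    · have : ∀ᵐ y : En n, y ≠ 0 := by simp [ae_iff]
      filter_upwards [this] with y hy
      refine tendsto_const_nhds.congr' ?_
      have h2 : Tendsto (fun k => 2 * ε k) atTop (nhds 0) := by simpa using hεlim.const_mul 2
      filter_upwards [h2.eventually_le_const (norm_pos_iff.2 hy)] with k hk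
      rw [hηone _ (hεpos k) y hk, one_mul]
  refine tendsto_nhds_unique hlim (squeeze_zero_norm' (a := fun k => K * ε k ^ α) ?_ ?_)
  · filter_upwards [hεlim.eventually_le_const (show (0 : ℝ) < 1 / 2 by norm_num)] with k hk
    exact hbound _ ⟨hεpos k, hk⟩
  · have := (hεlim.rpow_const (Or.inr hα.le)).const_mul K
    simpa [Real.zero_rpow hα.ne'] using this

open scoped ContDiff

/-- The Laplacian of a radial function. -/
lemma vlap_comp_norm_sub_sq {n : ℕ} {h : ℝ → ℝ} (hh : ContDiff ℝ 2 h) (c : ℝ) (x y : En n) :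
    vlap (fun y => h (c * ‖y - x‖ ^ 2)) y =
      2 * c * (n * deriv h (c * ‖y - x‖ ^ 2) +
        2 * (c * ‖y - x‖ ^ 2) * deriv (deriv h) (c * ‖y - x‖ ^ 2)) := by
  have hh' : ContDiff ℝ 1 (deriv h) := ContDiff.deriv' (hh.of_le (by norm_num))
  have hq (y : En n) : HasFDerivAt (fun y : En n => c * ‖y - x‖ ^ 2)
      (c • (2 • (innerSL ℝ (y - x)))) y := by
    simpa using ((hasFDerivAt_id y).sub_const x).norm_sq.const_mul c
  have hcomp {k : ℝ → ℝ} (hk : Differentiable ℝ k) (y : En n) :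
      HasFDerivAt (fun y : En n => k (c * ‖y - x‖ ^ 2))
        (deriv k (c * ‖y - x‖ ^ 2) • (c • (2 • (innerSL ℝ (y - x))))) y :=
    (hk _).hasDerivAt.comp_hasFDerivAt y (hq y)
  have hin (y : En n) (i : Fin n) : innerSL ℝ (y - x) (eb n i) = (y - x) i := by
    simp [eb, EuclideanSpace.inner_single_right]
  have h1 (i : Fin n) : (fun y => fderiv ℝ (fun y => h (c * ‖y - x‖ ^ 2)) y (eb n i)) =
      fun y => deriv h (c * ‖y - x‖ ^ 2) * (2 * c * (y - x) i) := by
    funext y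
    rw [(hcomp (hh.differentiable (by norm_num)) y).fderiv]
    simp only [smul_apply, hin, smul_eq_mul, nsmul_eq_mul]
    push_cast
    ring
  have h2 (i : Fin n) : fderiv ℝ (fun y => fderiv ℝ (fun y => h (c * ‖y - x‖ ^ 2)) y (eb n i)) y
      (eb n i) = 4 * c ^ 2 * deriv (deriv h) (c * ‖y - x‖ ^ 2) * (y - x) i ^ 2 +
        2 * c * deriv h (c * ‖y - x‖ ^ 2) := by
    rw [h1]
    have hl : HasFDerivAt (fun y : En n => 2 * c * (y - x) i)
        ((2 * c) • (EuclideanSpace.proj i : En n →L[ℝ] ℝ)) y :=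
      ((EuclideanSpace.proj i : En n →L[ℝ] ℝ).hasFDerivAt.comp y
        ((hasFDerivAt_id y).sub_const x)).const_mul (2 * c)
    have := ((hcomp (hh'.differentiable (by norm_num)) y).mul hl).fderiv
    refine (congrArg (fun T : En n →L[ℝ] ℝ => T (eb n i)) this).trans ?_
    have hp : (EuclideanSpace.proj i : En n →L[ℝ] ℝ) (eb n i) = 1 := by simp [eb]
    simp only [add_apply, smul_apply, hin, hp, smul_eq_mul,
      nsmul_eq_mul]
    push_cast
    ring
  simp only [vlap, h2, Finset.sum_add_distrib, ← Finset.mul_sum, ← EuclideanSpace.real_norm_sq_eq]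
  simp
  ring

lemma exists_antitone_contDiff_cutoff :
    ∃ h : ℝ → ℝ, ContDiff ℝ ∞ h ∧ Antitone h ∧ 0 < h 0 ∧ ∀ s, 1 ≤ s → h s = 0 :=
  ⟨fun s => expNegInvGlue (1 - s), expNegInvGlue.contDiff.comp (contDiff_const.sub contDiff_id),
    fun _ _ hab => expNegInvGlue.monotone (by linarith),
    expNegInvGlue.pos_of_pos (by norm_num),
    fun _ hs => expNegInvGlue.zero_of_nonpos (by linarith)⟩

/-- The averages of a weakly harmonic function against the dilates of a radial kernel do not
depend on the scale. -/
lemma hasDerivAt_integral_mul_dilation {n : ℕ} {Φ : En n → ℝ} (hloc : LocallyIntegrable Φ)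
    (hweak : ∀ φ : En n → ℝ, ContDiff ℝ 2 φ → HasCompactSupport φ → ∫ y, Φ y * vlap φ y = 0)
    {h : ℝ → ℝ} (hh : ContDiff ℝ 2 h) (hh1 : ∀ s, 1 ≤ s → h s = 0) (x : En n) {t : ℝ}
    (ht : 0 < t) :
    HasDerivAt (fun t : ℝ => ∫ y, Φ y * (t ^ n * deriv h (t ^ 2 * ‖y - x‖ ^ 2))) 0 t := by
  have hh' : ContDiff ℝ 1 (deriv h) := ContDiff.deriv' (hh.of_le (by norm_num))
  have hc' : Continuous (deriv h) := hh'.continuous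
  have hc'' : Continuous (deriv (deriv h)) := hh'.continuous_deriv (by norm_num)
  have h0 : ∀ s, 1 < s → deriv h s = 0 := fun s hs => by
    have : h =ᶠ[nhds s] fun _ => 0 :=
      mem_of_superset (Ioi_mem_nhds hs) fun r hr => hh1 r (le_of_lt hr)
    rw [this.deriv_eq]; simp
  have h0' : ∀ s, 1 < s → deriv (deriv h) s = 0 := fun s hs => by
    have : deriv h =ᶠ[nhds s] fun _ => 0 := mem_of_superset (Ioi_mem_nhds hs) fun r hr => h0 r hr
    rw [this.deriv_eq]; simp
  set G : ℝ → En n → ℝ := fun t y => t ^ n * deriv h (t ^ 2 * ‖y - x‖ ^ 2)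
  set G' : ℝ → En n → ℝ := fun t y => n * t ^ (n - 1) * deriv h (t ^ 2 * ‖y - x‖ ^ 2) +
    t ^ n * (deriv (deriv h) (t ^ 2 * ‖y - x‖ ^ 2) * (2 * t * ‖y - x‖ ^ 2)) with hG'
  have hGc : ∀ t, Continuous (G t) := fun t => by fun_prop
  have hG'c : Continuous fun p : ℝ × En n => G' p.1 p.2 := by fun_prop
  have hd : ∀ r y, HasDerivAt (fun r => G r y) (G' r y) r := fun r y => by
    have e1 : HasDerivAt (fun r : ℝ => r ^ 2 * ‖y - x‖ ^ 2) (2 * r * ‖y - x‖ ^ 2) r := by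
      simpa using (hasDerivAt_pow 2 r).mul_const (‖y - x‖ ^ 2)
    exact (hasDerivAt_pow n r).mul ((hh'.differentiable (by norm_num) _).hasDerivAt.comp r e1)
  have hbig : ∀ r y, t / 2 < r → y ∉ closedBall x (2 / t) → 1 < r ^ 2 * ‖y - x‖ ^ 2 := by
    intro r y hr hy
    rw [mem_closedBall, dist_eq_norm, not_le] at hy
    rw [← mul_pow]
    refine one_lt_pow₀ ?_ two_ne_zero
    calc (1 : ℝ) = t / 2 * (2 / t) := by field_simp
      _ < r * ‖y - x‖ := by gcongr
  obtain ⟨B, hB⟩ := ((isCompact_Icc (a := t / 2) (b := 3 * t / 2)).prod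
    (isCompact_closedBall x (2 / t))).exists_bound_of_continuousOn hG'c.continuousOn
  have key := (hasDerivAt_integral_of_dominated_loc_of_deriv_le (μ := volume)
    (F := fun t y => Φ y * G t y) (F' := fun t y => Φ y * G' t y) (x₀ := t)
    (s := Ioo (t / 2) (3 * t / 2))
    (bound := (closedBall x (2 / t)).indicator fun y => ‖Φ y‖ * B)
    (Ioo_mem_nhds (by linarith) (by linarith))
    (Eventually.of_forall fun t =>
      hloc.aestronglyMeasurable.mul (hGc t).aestronglyMeasurable)
    (hloc.integrable_smul_right_of_hasCompactSupport (hGc t)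
      (HasCompactSupport.intro (isCompact_closedBall x (2 / t)) fun y hy => by
        simp [G, h0 _ (hbig t y (by linarith) hy)]))
    (hloc.aestronglyMeasurable.mul
      (hG'c.comp (Continuous.prodMk_right t)).aestronglyMeasurable)
    (ae_of_all _ fun y r hr => by
      by_cases hy : y ∈ closedBall x (2 / t)
      · rw [indicator_of_mem hy, norm_mul]
        gcongr
        exact hB (r, y) ⟨⟨hr.1.le, hr.2.le⟩, hy⟩
      · have := hbig r y hr.1 hy
        simp [indicator_of_notMem hy, hG', h0 _ this, h0' _ this])
    ((integrable_indicator_iff measurableSet_closedBall).2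
      ((hloc.integrableOn_isCompact (isCompact_closedBall _ _)).norm.mul_const B))
    (ae_of_all _ fun y r _ => (hd r y).const_mul (Φ y))).2
  refine key.congr_deriv ?_
  have hφ : ContDiff ℝ 2 fun y : En n => h (t ^ 2 * ‖y - x‖ ^ 2) :=
    hh.comp (contDiff_const.mul ((contDiff_id.sub contDiff_const).norm_sq ℝ))
  have hφc : HasCompactSupport fun y : En n => h (t ^ 2 * ‖y - x‖ ^ 2) :=
    HasCompactSupport.intro (isCompact_closedBall x (2 / t)) fun y hy =>
      hh1 _ (hbig t y (by linarith) hy).le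
  have hid : ∀ y, Φ y * G' t y =
      t ^ n / (2 * t ^ 3) * (Φ y * vlap (fun y => h (t ^ 2 * ‖y - x‖ ^ 2)) y) := fun y => by
    rw [vlap_comp_norm_sub_sq hh]
    have : (n : ℝ) * t ^ (n - 1) = n * t ^ n / t := by
      rcases n with _ | n
      · simp
      · rw [Nat.add_sub_cancel, pow_succ]; field_simp
    simp only [hG', this]
    field_simp
  rw [integral_congr_ae (ae_of_all _ hid), integral_const_mul, hweak _ hφ hφc, mul_zero]

/-- **Weyl's lemma**: a locally bounded weakly harmonic function agrees at its points of continuity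
with a smooth function. -/
lemma exists_contDiff_eq_of_weakly_harmonic {n : ℕ} (hn : n ≠ 0) {Φ : En n → ℝ}
    (hm : Measurable Φ) (hb : ∀ R : ℝ, ∃ M, ∀ x, ‖x‖ ≤ R → |Φ x| ≤ M)
    (hweak : ∀ φ : En n → ℝ, ContDiff ℝ 2 φ → HasCompactSupport φ → ∫ y, Φ y * vlap φ y = 0) :
    ∃ Ψ : En n → ℝ, ContDiff ℝ ∞ Ψ ∧ ∀ x, ContinuousAt Φ x → Ψ x = Φ x := by
  have hloc : LocallyIntegrable Φ := locallyIntegrable_of_forall_abs_le hm hb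
  obtain ⟨h, hh, hanti, hpos, hh1⟩ := exists_antitone_contDiff_cutoff
  have hh2 : ContDiff ℝ 2 h := contDiff_infty.1 hh 2
  have hh' : ContDiff ℝ ∞ (deriv h) := (contDiff_infty_iff_deriv.1 hh).2
  set ρ : En n → ℝ := fun z => deriv h (‖z‖ ^ 2) with hρ
  have hρc : ContDiff ℝ ∞ ρ := hh'.comp (contDiff_id.norm_sq ℝ)
  have hρ0 : ∀ z, 1 < ‖z‖ → ρ z = 0 := fun z hz => by
    have : h =ᶠ[nhds (‖z‖ ^ 2)] fun _ => 0 :=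
      mem_of_superset (Ioi_mem_nhds (one_lt_pow₀ hz two_ne_zero)) fun r hr => hh1 r (le_of_lt hr)
    simp [hρ, this.deriv_eq]
  have hρs : HasCompactSupport ρ := HasCompactSupport.intro (isCompact_closedBall 0 1)
    fun z hz => hρ0 z (by simpa using hz)
  have hρint : Integrable ρ := hρc.continuous.integrable_of_hasCompactSupport hρs
  have hne : ∫ z, ρ z ≠ 0 := by
    obtain ⟨s, hs, hs'⟩ := exists_deriv_eq_slope h one_pos hh.continuous.continuousOn
      (hh2.differentiable (by norm_num)).differentiableOn
    rw [hh1 1 le_rfl] at hs'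
    have hz : -ρ (√s • eb n ⟨0, Nat.pos_of_ne_zero hn⟩) ≠ 0 := by
      have : ‖√s • eb n ⟨0, Nat.pos_of_ne_zero hn⟩‖ ^ 2 = s := by
        rw [norm_smul]
        simp [eb, Real.sq_sqrt hs.1.le]
      simp only [hρ, this, hs']
      simp [hpos.ne']
    have := hρc.continuous.neg.integral_pos_of_hasCompactSupport_nonneg_nonzero (μ := volume)
      (hρs.comp_left (g := fun r => -r) neg_zero) (fun z => by simpa using hanti.deriv_nonpos) hz
    simp only [Pi.neg_apply, integral_neg] at this
    linarith
  have hconst : ∀ x, ∀ t : ℝ, 0 < t →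
      ∫ y, Φ y * ρ (y - x) = ∫ y, Φ y * (t ^ n * deriv h (t ^ 2 * ‖y - x‖ ^ 2)) := by
    intro x t ht
    have hd := fun (t : ℝ) (ht : t ∈ Ioi (0 : ℝ)) =>
      hasDerivAt_integral_mul_dilation hloc hweak hh2 hh1 x ht
    have := isOpen_Ioi.is_const_of_deriv_eq_zero isPreconnected_Ioi
      (fun t ht => (hd t ht).differentiableAt.differentiableWithinAt)
      (fun t ht => (hd t ht).deriv) (mem_Ioi.2 one_pos) (mem_Ioi.2 ht)
    simpa using this
  have hscale : ∀ x, ∀ t : ℝ, 0 < t →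
      ∫ y, Φ y * ρ (y - x) = ∫ z, Φ (x + t⁻¹ • z) * ρ z := by
    intro x t ht
    have e1 := Measure.integral_comp_smul (volume : Measure (En n))
      (fun z => Φ (x + t⁻¹ • z) * ρ z) t
    rw [← integral_sub_right_eq_self _ x, finrank_euclideanSpace_fin,
      abs_of_pos (by positivity), smul_eq_mul, eq_inv_mul_iff_mul_eq₀ (by positivity),
      ← integral_const_mul] at e1
    rw [hconst x t ht, ← e1]
    congr 1 with y
    rw [inv_smul_smul₀ ht.ne', add_sub_cancel]
    simp only [hρ, norm_smul, Real.norm_of_nonneg ht.le, mul_pow]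
    ring
  refine ⟨fun x => (∫ z, ρ z)⁻¹ * ∫ y, Φ y * ρ (y - x), ?_, fun x hx => ?_⟩
  · have := hρs.contDiff_convolution_right (n := ⊤) (ContinuousLinearMap.mul ℝ ℝ) hloc hρc
    refine contDiff_const.mul ?_
    refine (funext fun x => ?_ : (fun x => ∫ y, Φ y * ρ (y - x)) = _) ▸ this
    rw [convolution_def]
    congr 1 with y
    simp [hρ, norm_sub_rev x y]
  · rw [inv_mul_eq_iff_eq_mul₀ hne, ← integral_mul_const]
    obtain ⟨M, hM⟩ := hb (‖x‖ + 1)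
    have hlim : Tendsto (fun k : ℕ => ∫ z, Φ (x + ((k : ℝ) + 1)⁻¹ • z) * ρ z) atTop
        (nhds (∫ z, ρ z * Φ x)) := by
      refine tendsto_integral_of_dominated_convergence (fun z => M * ‖ρ z‖) (fun k => ?_)
        (hρint.norm.const_mul M) (fun k => ae_of_all _ fun z => ?_) (ae_of_all _ fun z => ?_)
      · exact (hm.comp (by fun_prop)).aestronglyMeasurable.mul hρint.1
      · rw [norm_mul]
        rcases lt_or_ge 1 ‖z‖ with hz | hz
        · simp [hρ0 z hz]
        · gcongr
          refine hM _ ((norm_add_le _ _).trans ?_)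
          gcongr
          rw [norm_smul, norm_inv, Real.norm_of_nonneg (by positivity)]
          exact mul_le_one₀ (inv_le_one_of_one_le₀ (by linarith [k.cast_nonneg (α := ℝ)]))
            (norm_nonneg _) hz
      · rw [mul_comm (ρ z)]
        refine Tendsto.mul_const _ (hx.tendsto.comp ?_)
        have h1 : Tendsto (fun k : ℕ => ((k : ℝ) + 1)⁻¹) atTop (nhds 0) := by
          simpa using tendsto_one_div_add_atTop_nhds_zero_nat (𝕜 := ℝ)
        simpa using (h1.smul_const z).const_add x
    refine tendsto_nhds_unique (tendsto_const_nhds.congr fun k => ?_) hlim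
    exact hscale x (k + 1) (by positivity)

/-- **Proposition 2.8**: removable singularity theorem for harmonic functions under
the gradient bound `|∇Φ(x)| = O(|x|^{α−1})` near the singular point. -/
theorem harmonic_removable_singularity
    (n : ℕ) (hn : 2 ≤ n) (α : ℝ) (hα : α ∈ Ioo (0 : ℝ) 1) (Φ : En n → ℝ)
    -- Φ is harmonic on ℝⁿ \ {0}
    (hreg : ContDiffOn ℝ 2 Φ {(0 : En n)}ᶜ)
    (hharm : ∀ x : En n, x ≠ 0 → vlap Φ x = 0)
    -- sup { |x|^{1−α} |∇Φ(x)| : 0 < |x| ≤ 1 } < ∞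
    (hbd : ∃ C : ℝ, ∀ x : En n, x ≠ 0 → ‖x‖ ≤ 1 → ‖x‖ ^ (1 - α) * ‖gradient Φ x‖ ≤ C) :
    ∃ Ψ : En n → ℝ, ContDiff ℝ 2 Ψ ∧ (∀ x : En n, vlap Ψ x = 0) ∧
      ∀ x : En n, x ≠ 0 → Ψ x = Φ x := by
  obtain ⟨hα0, hα1⟩ := hα
  obtain ⟨C, hC⟩ := hbd
  have : Nonempty (Fin n) := ⟨⟨0, by omega⟩⟩
  have hreg' : ∀ x ≠ 0, ContDiffAt ℝ 2 Φ x := fun x hx =>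
    hreg.contDiffAt (isOpen_compl_singleton.mem_nhds hx)
  have hgrad : ∀ x : En n, x ≠ 0 → ‖x‖ ≤ 1 → ‖fderiv ℝ Φ x‖ ≤ C * ‖x‖ ^ (α - 1) := by
    intro x hx hx1
    have hpos : 0 < ‖x‖ := norm_pos_iff.2 hx
    have h1 := hC x hx hx1
    rw [gradient, LinearIsometryEquiv.norm_map] at h1
    rw [← neg_sub 1 α, Real.rpow_neg hpos.le, ← div_eq_mul_inv,
      le_div_iff₀ (Real.rpow_pos_of_pos hpos _)]
    linarith
  have hb := exists_abs_le_of_norm_fderiv_le hα0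
    (fun x hx => (hreg' x hx).differentiableAt (by norm_num)) hgrad
  obtain ⟨Ψ, hΨ, hΨΦ⟩ := exists_contDiff_eq_of_weakly_harmonic (by omega)
    (measurable_of_continuousOn_compl_singleton 0 hreg.continuousOn) hb
    fun φ hφ hc => integral_mul_vlap_eq_zero hn hα0 hα1 hreg hharm hgrad hb hφ hc
  have hΨ2 : ContDiff ℝ 2 Ψ := contDiff_infty.1 hΨ 2
  have heq : ∀ x : En n, x ≠ 0 → Ψ x = Φ x := fun x hx => hΨΦ x (hreg' x hx).continuousAt
  refine ⟨Ψ, hΨ2, fun x => ?_, heq⟩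
  have hdense : Dense ({0}ᶜ : Set (En n)) := dense_compl_singleton 0
  refine congrFun (hΨ2.continuous_vlap.ext_on hdense (continuous_const (y := (0 : ℝ)))
    fun y hy => ?_) x
  have h1 : Ψ =ᶠ[nhds y] Φ :=
    mem_of_superset (isOpen_compl_singleton.mem_nhds hy) fun z hz => heq z hz
  have h2 (i : Fin n) : (fun z => fderiv ℝ Ψ z (eb n i)) =ᶠ[nhds y]
      fun z => fderiv ℝ Φ z (eb n i) := (h1.fderiv (𝕜 := ℝ)).mono fun z hz => by simp only [hz]
  change vlap Ψ y = 0
  rw [← hharm y hy]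
  simp only [vlap, (h2 _).fderiv_eq]
end
end

section
/- Let n ≥ 2 and α ∈ (0,1). There exists a constant C > 0 depending only on n and α such that for every smooth compactly supported g : ℝⁿ → ℝ, the Newtonian potential h(x) = ∫_{ℝⁿ} E(x−y) g(y) dy satisfies, for all indices i, j ∈ {1, …, n}, the Hölder estimate [∂ᵢ∂ⱼh]^{(α)}_{ℝⁿ} ≤ C [g]^{(α)}_{ℝⁿ}, where [f]^{(α)}_{ℝⁿ} = sup{ |f(x)−f(y)|/|x−y|^α : x, y ∈ ℝⁿ, x ≠ y }. -/
open MeasureTheory Set Metric Filter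

noncomputable section

/-- the Lebesgue volume of the unit ball of `ℝⁿ`. -/
def unitBallVol (n : ℕ) : ℝ := (volume (Metric.ball (0 : En n) 1)).toReal

/-- the fundamental solution of the Laplace equation on `ℝⁿ`:
`E(x) = Cₙ |x|^{2−n}` for `n ≥ 3` with `Cₙ = (a n (n−2))⁻¹`, and
`E(x) = −(2π)⁻¹ log |x|` for `n = 2`. -/
def fundSol (n : ℕ) (x : En n) : ℝ :=
  if n = 2 then -(1 / (2 * Real.pi)) * Real.log ‖x‖
  else (unitBallVol n * n * ((n : ℝ) - 2))⁻¹ * ‖x‖ ^ ((2 : ℝ) - n)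

/-- A smooth radial cutoff: equal to `1` on the unit ball and to `0` outside the ball of
radius `2`. -/
def cutoff (n : ℕ) (v : En n) : ℝ := Real.smoothTransition (2 - ‖v‖ ^ 2)

lemma contDiff_cutoff (n : ℕ) : ContDiff ℝ (⊤ : ℕ∞) (cutoff n) :=
  Real.smoothTransition.contDiff.comp (contDiff_const.sub (contDiff_norm_sq ℝ))

lemma cutoff_eq_zero {n : ℕ} {v : En n} (hv : 2 ≤ ‖v‖) : cutoff n v = 0 :=
  Real.smoothTransition.zero_of_nonpos (by nlinarith)

lemma hasCompactSupport_cutoff (n : ℕ) : HasCompactSupport (cutoff n) := by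
  refine HasCompactSupport.intro (isCompact_closedBall (0 : En n) 2) fun v hv => ?_
  rw [mem_closedBall_zero_iff, not_le] at hv
  exact cutoff_eq_zero hv.le

/-- The rescaled cutoff `t^{1-n} χ(v/t)`; its integral over the scales `t ∈ (0, R)` is an affine
function of the fundamental solution. -/
def scaleKernel (n : ℕ) (t : ℝ) (v : En n) : ℝ := t * (t ^ n)⁻¹ * cutoff n (t⁻¹ • v)

lemma measurable_scaleKernel (n : ℕ) :
    Measurable (fun p : ℝ × En n => scaleKernel n p.1 p.2) := by
  have h := (contDiff_cutoff n).continuous.measurable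
  unfold scaleKernel
  fun_prop

lemma integrable_cutoff (n : ℕ) : Integrable (cutoff n) :=
  (contDiff_cutoff n).continuous.integrable_of_hasCompactSupport (hasCompactSupport_cutoff n)

lemma integrable_scaleKernel (n : ℕ) (R : ℝ) :
    Integrable (fun p : ℝ × En n => scaleKernel n p.1 p.2)
      ((volume.restrict (Ioc 0 R)).prod volume) := by
  rw [integrable_prod_iff (measurable_scaleKernel n).aestronglyMeasurable]
  constructor
  · refine (ae_restrict_iff' measurableSet_Ioc).2 (.of_forall fun t ht => ?_)
    exact ((integrable_cutoff n).comp_smul (inv_ne_zero ht.1.ne')).const_mul (t * (t ^ n)⁻¹)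
  · have h : IntegrableOn (fun t : ℝ => t * ∫ v, ‖cutoff n v‖) (Ioc 0 R) :=
      ((continuous_id.mul continuous_const).integrableOn_Icc).mono_set Ioc_subset_Icc_self
    refine h.congr_fun (fun t ht => ?_) measurableSet_Ioc
    have ht0 : 0 < t := ht.1
    simp only [scaleKernel, norm_mul, norm_inv, norm_pow, Real.norm_of_nonneg ht0.le]
    rw [integral_const_mul,
      Measure.integral_comp_inv_smul_of_nonneg volume (fun v => ‖cutoff n v‖) ht0.le]
    simp only [finrank_euclideanSpace, Fintype.card_fin, smul_eq_mul]
    field_simp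

/-- The radial profile of `scaleKernel`. -/
def profile (n : ℕ) (t r : ℝ) : ℝ := t * (t ^ n)⁻¹ * Real.smoothTransition (2 - (t⁻¹ * r) ^ 2)

lemma scaleKernel_eq_profile (n : ℕ) {t : ℝ} (ht : 0 < t) (v : En n) :
    scaleKernel n t v = profile n t ‖v‖ := by
  simp [scaleKernel, profile, cutoff, norm_smul, abs_of_pos ht]

/-- The contribution of the transition region of the cutoff at unit radius. -/
def transitionConst (n : ℕ) : ℝ := ∫ s in (1 / 2 : ℝ)..1, profile n s 1

lemma transitionConst_nonneg (n : ℕ) : 0 ≤ transitionConst n := by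
  refine intervalIntegral.integral_nonneg (by norm_num) fun s hs => ?_
  have : 0 ≤ s := by linarith [hs.1]
  exact mul_nonneg (by positivity) (Real.smoothTransition.nonneg _)

lemma intervalIntegrable_profile (n : ℕ) {r a b : ℝ} (ha : 0 < a) (hb : 0 < b) :
    IntervalIntegrable (fun t => profile n t r) volume a b := by
  refine ContinuousOn.intervalIntegrable fun t ht => ?_
  have ht0 : t ≠ 0 := ((lt_min ha hb).trans_le ht.1).ne'
  have h := Real.smoothTransition.continuous
  unfold profile
  refine ContinuousAt.continuousWithinAt ?_
  refine ((continuousAt_id.mul ((continuousAt_id.pow n).inv₀ (pow_ne_zero n ht0)))).mul ?_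
  refine h.continuousAt.comp ?_
  exact continuousAt_const.sub (((continuousAt_id.inv₀ ht0).mul continuousAt_const).pow 2)

lemma integral_profile (n : ℕ) {r R : ℝ} (hr : 0 < r) (hR : r ≤ R) :
    ∫ t in Ioc 0 R, profile n t r
      = r ^ 2 * (r ^ n)⁻¹ * transitionConst n + ∫ t in r..R, t * (t ^ n)⁻¹ := by
  have hzero : ∀ t ∈ Ioc 0 (r / 2), profile n t r = 0 := by
    intro t ht
    have h2 : 2 ≤ t⁻¹ * r := by
      rw [inv_mul_eq_div, le_div_iff₀ ht.1]; linarith [ht.2]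
    rw [profile, Real.smoothTransition.zero_of_nonpos (by nlinarith), mul_zero]
  have i1 : IntervalIntegrable (fun t => profile n t r) volume 0 (r / 2) := by
    refine (intervalIntegrable_const (c := (0 : ℝ))).congr fun t ht => ?_
    rw [uIoc_of_le (by positivity)] at ht
    exact (hzero t ht).symm
  have e1 : ∫ t in (0 : ℝ)..r / 2, profile n t r = 0 := by
    rw [intervalIntegral.integral_of_le (by positivity)]
    exact setIntegral_eq_zero_of_forall_eq_zero hzero
  have i2 := intervalIntegrable_profile n (r := r) (half_pos hr) hr
  have i3 := intervalIntegrable_profile n (r := r) hr (hr.trans_le hR)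
  have e2 : ∫ t in r / 2..r, profile n t r = r ^ 2 * (r ^ n)⁻¹ * transitionConst n := by
    have h := intervalIntegral.integral_comp_mul_left (a := 1 / 2) (b := 1)
      (fun t => profile n t r) hr.ne'
    have hp : ∀ s : ℝ, profile n (r * s) r = r * (r ^ n)⁻¹ * profile n s 1 := by
      intro s
      have : (r * s)⁻¹ * r = s⁻¹ * 1 := by
        rw [mul_inv, mul_comm r⁻¹, mul_assoc, inv_mul_cancel₀ hr.ne']
      rw [profile, profile, this, mul_pow, mul_inv (r ^ n)]
      ring
    simp only [hp, intervalIntegral.integral_const_mul, smul_eq_mul] at h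
    rw [mul_one, show r * (1 / 2) = r / 2 by ring, eq_inv_mul_iff_mul_eq₀ hr.ne'] at h
    rw [← h, transitionConst]
    ring
  have e3 : ∫ t in r..R, profile n t r = ∫ t in r..R, t * (t ^ n)⁻¹ := by
    refine intervalIntegral.integral_congr fun t ht => ?_
    rw [uIcc_of_le hR] at ht
    have ht0 : 0 < t := hr.trans_le ht.1
    have h1 : t⁻¹ * r ≤ 1 := by
      rw [inv_mul_eq_div, div_le_one ht0]; exact ht.1
    have h0 : 0 ≤ t⁻¹ * r := by positivity
    simp only [profile]
    rw [Real.smoothTransition.one_of_one_le (by nlinarith), mul_one]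
  rw [← intervalIntegral.integral_of_le (hr.le.trans hR),
    ← intervalIntegral.integral_add_adjacent_intervals (i1.trans i2) i3,
    ← intervalIntegral.integral_add_adjacent_intervals i1 i2, e1, e2, e3, zero_add]

/-- Up to an additive constant, the fundamental solution is a superposition of the rescaled
cutoffs `scaleKernel`. -/
lemma exists_fundSol_eq (n : ℕ) (hn : 2 ≤ n) : ∃ a : ℝ, ∀ R > 0, ∃ b : ℝ, ∀ v : En n, v ≠ 0 →
    ‖v‖ ≤ R → fundSol n v = a * (∫ t in Ioc 0 R, scaleKernel n t v) + b := by
  have key : ∀ R : ℝ, ∀ v : En n, v ≠ 0 → ‖v‖ ≤ R → ∫ t in Ioc 0 R, scaleKernel n t v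
      = ‖v‖ ^ 2 * (‖v‖ ^ n)⁻¹ * transitionConst n + ∫ t in ‖v‖..R, t * (t ^ n)⁻¹ := by
    intro R v hv hR
    rw [← integral_profile n (norm_pos_iff.2 hv) hR]
    exact setIntegral_congr_fun measurableSet_Ioc fun t ht => scaleKernel_eq_profile n ht.1 v
  rcases eq_or_ne n 2 with rfl | hn2
  · refine ⟨1 / (2 * Real.pi), fun R hR =>
      ⟨-(1 / (2 * Real.pi)) * (transitionConst 2 + Real.log R), fun v hv hvR => ?_⟩⟩
    have hr : 0 < ‖v‖ := norm_pos_iff.2 hv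
    have h : ∫ t in ‖v‖..R, t * (t ^ 2)⁻¹ = Real.log R - Real.log ‖v‖ := by
      rw [← Real.log_div hR.ne' hr.ne', ← integral_inv_of_pos hr hR]
      refine intervalIntegral.integral_congr fun t ht => ?_
      rw [uIcc_of_le hvR] at ht
      have : 0 < t := hr.trans_le ht.1
      field_simp
    rw [key R v hv hvR, h, fundSol, if_pos rfl, mul_inv_cancel₀ (pow_pos hr 2).ne']
    ring
  · have hn3 : (2 : ℝ) < n := by exact_mod_cast lt_of_le_of_ne hn (Ne.symm hn2)
    have hD : 0 < transitionConst n + ((n : ℝ) - 2)⁻¹ :=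
      add_pos_of_nonneg_of_pos (transitionConst_nonneg n) (inv_pos.2 (by linarith))
    refine ⟨(unitBallVol n * n * ((n : ℝ) - 2))⁻¹ * (transitionConst n + ((n : ℝ) - 2)⁻¹)⁻¹,
      fun R hR => ⟨(unitBallVol n * n * ((n : ℝ) - 2))⁻¹ *
        (transitionConst n + ((n : ℝ) - 2)⁻¹)⁻¹ * (((n : ℝ) - 2)⁻¹ * R ^ ((2 : ℝ) - n)),
        fun v hv hvR => ?_⟩⟩
    have hr : 0 < ‖v‖ := norm_pos_iff.2 hv
    have h : ∫ t in ‖v‖..R, t * (t ^ n)⁻¹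
        = ((n : ℝ) - 2)⁻¹ * (‖v‖ ^ ((2 : ℝ) - n) - R ^ ((2 : ℝ) - n)) := by
      have h1 : ∫ t in ‖v‖..R, t * (t ^ n)⁻¹ = ∫ t in ‖v‖..R, t ^ ((1 : ℝ) - n) := by
        refine intervalIntegral.integral_congr fun t ht => ?_
        rw [uIcc_of_le hvR] at ht
        have : 0 < t := hr.trans_le ht.1
        rw [Real.rpow_sub this, Real.rpow_one, Real.rpow_natCast, div_eq_mul_inv]
      rw [h1, integral_rpow]
      · rw [show (1 : ℝ) - n + 1 = 2 - n by ring, ← neg_sub ((n : ℝ)) 2, div_neg,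
          div_eq_inv_mul]
        ring
      · refine Or.inr ⟨by linarith, ?_⟩
        rw [uIcc_of_le hvR]
        exact fun h0 => absurd h0.1 (not_le.2 hr)
    have hp : ‖v‖ ^ 2 * (‖v‖ ^ n)⁻¹ = ‖v‖ ^ ((2 : ℝ) - n) := by
      rw [Real.rpow_sub hr, Real.rpow_natCast, div_eq_mul_inv]
      norm_cast
    rw [key R v hv hvR, h, hp, fundSol, if_neg hn2]
    generalize ‖v‖ ^ ((2 : ℝ) - n) = p
    generalize R ^ ((2 : ℝ) - n) = q
    have : (transitionConst n + ((n : ℝ) - 2)⁻¹)⁻¹ * (transitionConst n + ((n : ℝ) - 2)⁻¹) = 1 :=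
      inv_mul_cancel₀ hD.ne'
    linear_combination (-(unitBallVol n * n * ((n : ℝ) - 2))⁻¹ * p) * this

lemma locallyIntegrable_fundSol (n : ℕ) (hn : 2 ≤ n) : LocallyIntegrable (fundSol n) := by
  have : Nontrivial (En n) := by
    have : Nonempty (Fin n) := ⟨⟨0, by omega⟩⟩
    infer_instance
  obtain ⟨a, ha⟩ := exists_fundSol_eq n hn
  rw [locallyIntegrable_iff]
  intro K hK
  obtain ⟨R, hR, hKR⟩ := hK.isBounded.subset_closedBall_lt 0 0
  obtain ⟨b, hb⟩ := ha R hR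
  refine IntegrableOn.mono_set ?_ hKR
  have h1 : IntegrableOn (fun v => a * (∫ t in Ioc 0 R, scaleKernel n t v) + b)
      (closedBall (0 : En n) R) := by
    refine ((integrable_scaleKernel n R).integral_prod_right.integrableOn.const_mul a).add ?_
    exact integrableOn_const (measure_closedBall_lt_top.ne)
  refine h1.congr ?_
  rw [Filter.EventuallyEq, ae_restrict_iff' measurableSet_closedBall]
  filter_upwards [Measure.ae_ne volume (0 : En n)] with v hv hvR
  exact (hb v hv (mem_closedBall_zero_iff.1 hvR)).symm

/-- The integral of the fundamental solution against a mean-zero test function, decomposed over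
scales. -/
lemma exists_integral_fundSol_mul_eq (n : ℕ) (hn : 2 ≤ n) : ∃ a : ℝ, ∀ q : En n → ℝ,
    Continuous q → HasCompactSupport q → ∫ v, q v = 0 → ∃ R : ℝ,
      ∫ v, fundSol n v * q v = a * ∫ t in Ioc 0 R, ∫ v, scaleKernel n t v * q v := by
  have : Nontrivial (En n) := by
    have : Nonempty (Fin n) := ⟨⟨0, by omega⟩⟩
    infer_instance
  obtain ⟨a, ha⟩ := exists_fundSol_eq n hn
  refine ⟨a, fun q hq hqc hq0 => ?_⟩
  obtain ⟨R, hR, hKR⟩ := hqc.isCompact.isBounded.subset_closedBall_lt 0 0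
  obtain ⟨b, hb⟩ := ha R hR
  obtain ⟨M, hM⟩ := hq.bounded_above_of_compact_support hqc
  refine ⟨R, ?_⟩
  have hint : Integrable (fun p : ℝ × En n => scaleKernel n p.1 p.2 * q p.2)
      ((volume.restrict (Ioc 0 R)).prod volume) :=
    (integrable_scaleKernel n R).mul_bdd (c := M)
      (hq.comp continuous_snd).aestronglyMeasurable (.of_forall fun p => hM p.2)
  have h1 : ∫ v, fundSol n v * q v
      = ∫ v, (a * (∫ t in Ioc 0 R, scaleKernel n t v * q v) + b * q v) := by
    refine integral_congr_ae ?_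
    filter_upwards [Measure.ae_ne volume (0 : En n)] with v hv
    rw [integral_mul_const]
    by_cases hvq : q v = 0
    · simp [hvq]
    · rw [hb v hv (mem_closedBall_zero_iff.1 (hKR (subset_tsupport q hvq)))]
      ring
  rw [h1, integral_add (hint.integral_prod_right.const_mul a)
    ((hq.integrable_of_hasCompactSupport hqc).const_mul b), integral_const_mul,
    integral_const_mul, hq0, mul_zero, add_zero]
  congr 1
  exact (integral_integral_swap hint).symm

lemma contDiff_fderiv_const {n : ℕ} {f : En n → ℝ} (hf : ContDiff ℝ (⊤ : ℕ∞) f) (e : En n) :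
    ContDiff ℝ (⊤ : ℕ∞) (fun y => fderiv ℝ f y e) :=
  (hf.fderiv_right (m := (⊤ : ℕ∞)) (by simp)).clm_apply contDiff_const

/-- Differentiation under the integral sign for the convolution with a test function. -/
lemma fderiv_integral_mul_sub {n : ℕ} {f g : En n → ℝ} (hf : LocallyIntegrable f)
    (hg : ContDiff ℝ (⊤ : ℕ∞) g) (hgc : HasCompactSupport g) (x e : En n) :
    fderiv ℝ (fun w => ∫ v, f v * g (w - v)) x e = ∫ v, f v * fderiv ℝ g (x - v) e := by
  have h := hgc.hasFDerivAt_convolution_right (ContinuousLinearMap.mul ℝ ℝ) hf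
    (hg.of_le (by simp)) x
  have h' : fderiv ℝ (fun w => ∫ v, f v * g (w - v)) x = _ := h.fderiv
  rw [h', convolution_precompR_apply _ hf (hgc.fderiv ℝ) (hg.continuous_fderiv (by simp))]
  rfl

/-- Integration by parts against a test function. -/
lemma integral_mul_fderiv_eq_neg {n : ℕ} {f g : En n → ℝ} (hf : ContDiff ℝ (⊤ : ℕ∞) f)
    (hfc : HasCompactSupport f) (hg : ContDiff ℝ (⊤ : ℕ∞) g) (e : En n) :
    ∫ u, f u * fderiv ℝ g u e = -∫ u, fderiv ℝ f u e * g u := by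
  have hf' := contDiff_fderiv_const hf e
  have hg' := contDiff_fderiv_const hg e
  refine integral_mul_fderiv_eq_neg_fderiv_mul_of_integrable ?_ ?_ ?_
    (fun x _ => hf.differentiable (by simp) x) (fun x _ => hg.differentiable (by simp) x)
  · exact (hf'.continuous.mul hg.continuous).integrable_of_hasCompactSupport
      ((hfc.fderiv_apply ℝ e).mul_right)
  · exact (hf.continuous.mul hg'.continuous).integrable_of_hasCompactSupport hfc.mul_right
  · exact (hf.continuous.mul hg.continuous).integrable_of_hasCompactSupport hfc.mul_right

lemma integral_fderiv_eq_zero {n : ℕ} {g : En n → ℝ} (hg : ContDiff ℝ (⊤ : ℕ∞) g)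
    (hgc : HasCompactSupport g) (e : En n) : ∫ u, fderiv ℝ g u e = 0 := by
  have h := integral_mul_fderiv_eq_neg hg hgc (contDiff_const (c := (1 : ℝ))) e
  simpa using h

/-- The second derivative `∂ⱼ∂ᵢf`. -/
def secondPartial {n : ℕ} (f : En n → ℝ) (i j : Fin n) (u : En n) : ℝ :=
  fderiv ℝ (fun y => fderiv ℝ f y (eb n i)) u (eb n j)

lemma contDiff_secondPartial {n : ℕ} {f : En n → ℝ} (hf : ContDiff ℝ (⊤ : ℕ∞) f) (i j : Fin n) :
    ContDiff ℝ (⊤ : ℕ∞) (secondPartial f i j) :=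
  contDiff_fderiv_const (contDiff_fderiv_const hf _) _

lemma hasCompactSupport_secondPartial {n : ℕ} {f : En n → ℝ} (hf : HasCompactSupport f)
    (i j : Fin n) : HasCompactSupport (secondPartial f i j) :=
  (hf.fderiv_apply ℝ (eb n i)).fderiv_apply ℝ (eb n j)

lemma secondPartial_cutoff_eq_zero {n : ℕ} (i j : Fin n) {v : En n} (hv : 2 < ‖v‖) :
    secondPartial (cutoff n) i j v = 0 := by
  have h0 : cutoff n =ᶠ[nhds v] fun _ => 0 := by
    filter_upwards [(isOpen_lt continuous_const continuous_norm).mem_nhds hv] with w hw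
    exact cutoff_eq_zero (le_of_lt hw)
  have h1 : (fun y => fderiv ℝ (cutoff n) y (eb n i)) =ᶠ[nhds v] fun _ => 0 := by
    filter_upwards [h0.fderiv (𝕜 := ℝ)] with w hw
    simp [hw]
  simp [secondPartial, h1.fderiv_eq]

lemma fderiv_comp_smul_sub {n : ℕ} {f : En n → ℝ} (hf : ContDiff ℝ (⊤ : ℕ∞) f) (s : ℝ)
    (x u e : En n) :
    fderiv ℝ (fun u => f (s • (x - u))) u e = -s * fderiv ℝ f (s • (x - u)) e := by
  have h1 : HasFDerivAt (fun u : En n => s • (x - u))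
      (s • (-ContinuousLinearMap.id ℝ (En n))) u := by
    exact ((hasFDerivAt_id u).const_sub x).const_smul s
  have h2 := (hf.differentiable (by simp) (s • (x - u))).hasFDerivAt.comp u h1
  have h3 : fderiv ℝ (fun u => f (s • (x - u))) u = _ := h2.fderiv
  rw [h3]
  simp

lemma contDiff_comp_smul_sub {n : ℕ} {f : En n → ℝ} (hf : ContDiff ℝ (⊤ : ℕ∞) f) (s : ℝ)
    (x : En n) : ContDiff ℝ (⊤ : ℕ∞) (fun u => f (s • (x - u))) :=
  hf.comp ((contDiff_const.sub contDiff_id).const_smul s)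

lemma hasCompactSupport_comp_smul_sub {n : ℕ} {f : En n → ℝ} (hf : HasCompactSupport f) {s : ℝ}
    (hs : s ≠ 0) (x : En n) : HasCompactSupport (fun u => f (s • (x - u))) :=
  hf.comp_homeomorph ((Homeomorph.subLeft x).trans (Homeomorph.smulOfNeZero s hs))

lemma integral_scaleKernel_mul_secondPartial {n : ℕ} {g : En n → ℝ}
    (hg : ContDiff ℝ (⊤ : ℕ∞) g) (i j : Fin n) {t : ℝ} (ht : 0 < t) (x : En n) (c : ℝ) :
    ∫ v, scaleKernel n t v * secondPartial g i j (x - v)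
      = t⁻¹ * (t ^ n)⁻¹ *
        ∫ u, secondPartial (cutoff n) j i (t⁻¹ • (x - u)) * (g u - c) := by
  have hs : t⁻¹ ≠ 0 := inv_ne_zero ht.ne'
  have hχ := contDiff_cutoff n
  have hχc := hasCompactSupport_cutoff n
  have h1 : ∫ u, cutoff n (t⁻¹ • (x - u)) * secondPartial g i j u
      = t⁻¹ * ∫ u, fderiv ℝ (cutoff n) (t⁻¹ • (x - u)) (eb n j) * fderiv ℝ g u (eb n i) := by
    refine (integral_mul_fderiv_eq_neg (contDiff_comp_smul_sub hχ t⁻¹ x)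
      (hasCompactSupport_comp_smul_sub hχc hs x) (contDiff_fderiv_const hg _) _).trans ?_
    simp only [fderiv_comp_smul_sub hχ, mul_assoc, integral_const_mul]
    ring
  have h2 : ∫ u, fderiv ℝ (cutoff n) (t⁻¹ • (x - u)) (eb n j) * fderiv ℝ g u (eb n i)
      = t⁻¹ * ∫ u, secondPartial (cutoff n) j i (t⁻¹ • (x - u)) * (g u - c) := by
    have hd := contDiff_fderiv_const hχ (eb n j)
    have h := integral_mul_fderiv_eq_neg (contDiff_comp_smul_sub hd t⁻¹ x)
      (hasCompactSupport_comp_smul_sub (hχc.fderiv_apply ℝ (eb n j)) hs x)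
      (hg.sub (contDiff_const (c := c))) (eb n i)
    simp only [fderiv_comp_smul_sub hd, fderiv_sub_const, mul_assoc, integral_const_mul] at h
    rw [h, neg_mul, neg_neg]
    rfl
  have h0 : ∫ v, scaleKernel n t v * secondPartial g i j (x - v)
      = t * (t ^ n)⁻¹ * ∫ u, cutoff n (t⁻¹ • (x - u)) * secondPartial g i j u := by
    rw [← integral_const_mul, ← integral_sub_left_eq_self _ volume x]
    simp only [scaleKernel, sub_sub_cancel, mul_assoc]
  rw [h0, h1, h2]
  field_simp

/-- Size bound for the integral of a function concentrated on a ball against the oscillation of a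
Hölder function. -/
lemma abs_integral_le_of_holder {n : ℕ} {α H m r : ℝ} {g F : En n → ℝ} {x : En n} (hα : 0 < α)
    (hH : 0 ≤ H) (hm : 0 ≤ m) (hr : 0 ≤ r) (hg : ∀ a b : En n, |g a - g b| ≤ H * ‖a - b‖ ^ α)
    (hF0 : ∀ u, r < ‖u - x‖ → F u = 0) (hF : ∀ u, |F u| ≤ m * |g u - g x|) :
    |∫ u, F u| ≤ m * (H * r ^ α) * (r ^ n * unitBallVol n) := by
  rw [← setIntegral_eq_integral_of_forall_compl_eq_zero (s := closedBall x r)]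
  · have h := norm_setIntegral_le_of_norm_le_const (μ := volume) (f := F) (s := closedBall x r)
      (C := m * (H * r ^ α)) measure_closedBall_lt_top ?_
    · rw [Measure.addHaar_real_closedBall volume x hr, finrank_euclideanSpace,
        Fintype.card_fin] at h
      exact h
    · intro u hu
      refine (hF u).trans (mul_le_mul_of_nonneg_left ((hg u x).trans ?_) hm)
      refine mul_le_mul_of_nonneg_left ?_ hH
      exact Real.rpow_le_rpow (norm_nonneg _) (mem_closedBall_iff_norm.1 hu) hα.le
  · intro u hu
    rw [mem_closedBall_iff_norm, not_le] at hu
    exact hF0 u hu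

/-- The dominating function for the scale-by-scale estimate. -/
def scaleBound (α δ t : ℝ) : ℝ := if t ≤ δ then t ^ (α - 1) else δ * t ^ (α - 2)

lemma scaleBound_nonneg {α δ t : ℝ} (hδ : 0 < δ) (ht : 0 ≤ t) : 0 ≤ scaleBound α δ t := by
  unfold scaleBound
  split_ifs <;> positivity

lemma integral_scaleBound {α δ : ℝ} (hα : α ∈ Ioo (0 : ℝ) 1) (hδ : 0 < δ) :
    IntegrableOn (scaleBound α δ) (Ioi 0) ∧
      ∫ t in Ioi 0, scaleBound α δ t = (α⁻¹ + (1 - α)⁻¹) * δ ^ α := by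
  have h1 : EqOn (fun t => t ^ (α - 1)) (scaleBound α δ) (Ioc 0 δ) := fun t ht =>
    (if_pos ht.2).symm
  have h2 : EqOn (fun t => δ * t ^ (α - 2)) (scaleBound α δ) (Ioi δ) := fun t ht =>
    (if_neg (not_le.2 ht)).symm
  have hα0 := hα.1
  have hα1 := hα.2
  have i1 : IntegrableOn (scaleBound α δ) (Ioc 0 δ) := by
    refine IntegrableOn.congr_fun ?_ h1 measurableSet_Ioc
    exact (intervalIntegrable_iff_integrableOn_Ioc_of_le hδ.le).1
      (intervalIntegral.intervalIntegrable_rpow' (by linarith))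
  have i2 : IntegrableOn (scaleBound α δ) (Ioi δ) :=
    IntegrableOn.congr_fun ((integrableOn_Ioi_rpow_of_lt (by linarith) hδ).const_mul δ) h2
      measurableSet_Ioi
  rw [← Ioc_union_Ioi_eq_Ioi hδ.le]
  refine ⟨i1.union i2, ?_⟩
  rw [setIntegral_union Ioc_disjoint_Ioi_same measurableSet_Ioi i1 i2,
    ← setIntegral_congr_fun measurableSet_Ioc h1, ← setIntegral_congr_fun measurableSet_Ioi h2,
    integral_const_mul, integral_Ioi_rpow_of_lt (by linarith) hδ,
    ← intervalIntegral.integral_of_le hδ.le, integral_rpow (Or.inl (by linarith)),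
    show α - 1 + 1 = α by ring, show α - 2 + 1 = α - 1 by ring, Real.zero_rpow hα0.ne',
    Real.rpow_sub_one hδ.ne', ← neg_sub 1 α]
  have : 1 - α ≠ 0 := by linarith
  field_simp
  ring

/-- At each scale, the difference of the second derivatives at two points is controlled by
`scaleBound`. -/
lemma exists_abs_scale_difference_le {n : ℕ} {α : ℝ} (hα : 0 < α) (i j : Fin n) :
    ∃ K : ℝ, 0 ≤ K ∧ ∀ g : En n → ℝ, ContDiff ℝ (⊤ : ℕ∞) g → ∀ H : ℝ, 0 ≤ H →
      (∀ a b : En n, |g a - g b| ≤ H * ‖a - b‖ ^ α) → ∀ x y : En n, ∀ t : ℝ, 0 < t →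
      |(∫ v, scaleKernel n t v * secondPartial g i j (x - v))
        - ∫ v, scaleKernel n t v * secondPartial g i j (y - v)|
        ≤ K * H * scaleBound α ‖x - y‖ t := by
  set Φ := secondPartial (cutoff n) j i with hΦdef
  have hΦ : ContDiff ℝ (⊤ : ℕ∞) Φ := contDiff_secondPartial (contDiff_cutoff n) j i
  have hΦc : HasCompactSupport Φ := hasCompactSupport_secondPartial (hasCompactSupport_cutoff n) j i
  have hΦ0 : ∀ {t : ℝ}, 0 < t → ∀ x u : En n, 2 * t < ‖u - x‖ → Φ (t⁻¹ • (x - u)) = 0 := by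
    intro t ht x u h
    refine secondPartial_cutoff_eq_zero j i ?_
    rw [norm_smul, norm_inv, Real.norm_of_nonneg ht.le, norm_sub_rev, inv_mul_eq_div,
      lt_div_iff₀ ht]
    exact h
  obtain ⟨M, hM⟩ := hΦ.continuous.bounded_above_of_compact_support hΦc
  obtain ⟨L, hL⟩ := hΦ.lipschitzWith_of_hasCompactSupport hΦc (by simp)
  have hM0 : 0 ≤ M := (norm_nonneg _).trans (hM 0)
  have hV : 0 ≤ unitBallVol n := ENNReal.toReal_nonneg
  refine ⟨(2 * M + L) * (3 ^ α * 3 ^ n * unitBallVol n), by positivity, ?_⟩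
  intro g hg H hH hgH x y t ht
  set A := 3 ^ α * 3 ^ n * unitBallVol n with hA
  have hA0 : 0 ≤ A := by positivity
  have hscale : ∀ m : ℝ, t⁻¹ * (t ^ n)⁻¹ *
      (m * (H * (3 * t) ^ α) * ((3 * t) ^ n * unitBallVol n)) = m * A * H * t ^ (α - 1) := by
    intro m
    rw [Real.mul_rpow (by norm_num) ht.le, mul_pow, Real.rpow_sub_one ht.ne', hA]
    field_simp
  have hpos : 0 ≤ t⁻¹ * (t ^ n)⁻¹ := by positivity
  unfold scaleBound
  split_ifs with htδ
  · have hone : ∀ z : En n, |∫ v, scaleKernel n t v * secondPartial g i j (z - v)|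
        ≤ M * A * H * t ^ (α - 1) := by
      intro z
      rw [integral_scaleKernel_mul_secondPartial hg i j ht z (g z), abs_mul, abs_of_nonneg hpos,
        ← hscale M]
      refine mul_le_mul_of_nonneg_left ?_ hpos
      refine abs_integral_le_of_holder (x := z) hα hH hM0 (by positivity) hgH ?_ ?_
      · intro u hu
        rw [← hΦdef, hΦ0 ht z u (by linarith), zero_mul]
      · intro u
        rw [abs_mul]
        exact mul_le_mul_of_nonneg_right (hM _) (abs_nonneg _)
    have h := (abs_sub _ _).trans (add_le_add (hone x) (hone y))
    refine h.trans ?_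
    have hL0 : 0 ≤ (L : ℝ) * A * H * t ^ (α - 1) := by positivity
    linarith
  · rw [not_le] at htδ
    have hint : ∀ z : En n, Integrable fun u => Φ (t⁻¹ • (z - u)) * (g u - g x) := fun z =>
      ((contDiff_comp_smul_sub hΦ t⁻¹ z).continuous.mul
        (hg.continuous.sub continuous_const)).integrable_of_hasCompactSupport
        (hasCompactSupport_comp_smul_sub hΦc (inv_ne_zero ht.ne') z).mul_right
    rw [integral_scaleKernel_mul_secondPartial hg i j ht x (g x),
      integral_scaleKernel_mul_secondPartial hg i j ht y (g x), ← hΦdef, ← mul_sub,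
      ← integral_sub (hint x) (hint y), abs_mul, abs_of_nonneg hpos]
    have hδ0 := norm_nonneg (x - y)
    have h := abs_integral_le_of_holder (x := x) (g := g) (α := α) (H := H)
      (F := fun u => Φ (t⁻¹ • (x - u)) * (g u - g x) - Φ (t⁻¹ • (y - u)) * (g u - g x))
      (m := L * (t⁻¹ * ‖x - y‖)) (r := 3 * t) hα hH (by positivity) (by positivity) hgH ?_ ?_
    · refine (mul_le_mul_of_nonneg_left h hpos).trans ?_
      rw [hscale, show α - 2 = α - 1 - 1 by ring, Real.rpow_sub_one ht.ne' (α - 1)]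
      have h1 : 0 ≤ 2 * M * A * H * (‖x - y‖ * (t ^ (α - 1) / t)) := by positivity
      calc _ = L * A * H * (‖x - y‖ * (t ^ (α - 1) / t)) := by field_simp
        _ ≤ _ := by linarith
    · intro u hu
      have hyu : 2 * t < ‖u - y‖ := by
        have := norm_sub_le_norm_sub_add_norm_sub u y x
        rw [norm_sub_rev y x] at this
        linarith
      rw [hΦ0 ht x u (by linarith), hΦ0 ht y u hyu, sub_self]
    · intro u
      rw [← sub_mul, abs_mul]
      refine mul_le_mul_of_nonneg_right ?_ (abs_nonneg _)
      have h := hL.dist_le_mul (t⁻¹ • (x - u)) (t⁻¹ • (y - u))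
      rw [Real.dist_eq, dist_eq_norm, ← smul_sub, sub_sub_sub_cancel_right, norm_smul, norm_inv,
        Real.norm_of_nonneg ht.le] at h
      exact h

lemma secondPartial_newtonian_potential {n : ℕ} (hn : 2 ≤ n) {g : En n → ℝ}
    (hg : ContDiff ℝ (⊤ : ℕ∞) g) (hgc : HasCompactSupport g) (i j : Fin n) (x : En n) :
    secondPartial (fun w => ∫ u : En n, fundSol n (w - u) * g u) i j x
      = ∫ v, fundSol n v * secondPartial g i j (x - v) := by
  have hE := locallyIntegrable_fundSol n hn
  have h0 : (fun w => ∫ u : En n, fundSol n (w - u) * g u)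
      = fun w => ∫ v, fundSol n v * g (w - v) := by
    funext w
    rw [← integral_sub_left_eq_self _ volume w]
    simp only [sub_sub_cancel]
  have h1 : (fun z => fderiv ℝ (fun w => ∫ v, fundSol n v * g (w - v)) z (eb n i))
      = fun z => ∫ v, fundSol n v * fderiv ℝ g (z - v) (eb n i) :=
    funext fun z => fderiv_integral_mul_sub hE hg hgc z _
  unfold secondPartial
  rw [h0, h1]
  exact fderiv_integral_mul_sub hE (contDiff_fderiv_const hg (eb n i))
    (hgc.fderiv_apply ℝ (eb n i)) x (eb n j)

/-- **Estimate (3.1)**: the interior Schauder-type Hölder estimate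
`[∂ᵢ∂ⱼ(E ∗ g)]^{(α)} ≤ C [g]^{(α)}` for the Newtonian potential. -/
theorem newtonian_potential_holder_estimate
    (n : ℕ) (hn : 2 ≤ n) (α : ℝ) (hα : α ∈ Ioo (0 : ℝ) 1) :
    ∃ C > (0 : ℝ), ∀ g : En n → ℝ, ContDiff ℝ (⊤ : ℕ∞) g → HasCompactSupport g →
      ∀ H : ℝ, (∀ a b : En n, |g a - g b| ≤ H * ‖a - b‖ ^ α) →
      ∀ i j : Fin n, ∀ x y : En n,
        |fderiv ℝ (fun z => fderiv ℝ (fun w => ∫ u : En n, fundSol n (w - u) * g u)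
            z (eb n i)) x (eb n j)
          - fderiv ℝ (fun z => fderiv ℝ (fun w => ∫ u : En n, fundSol n (w - u) * g u)
            z (eb n i)) y (eb n j)|
          ≤ C * H * ‖x - y‖ ^ α := by
  choose K hK0 hK using fun i j : Fin n => exists_abs_scale_difference_le (n := n) hα.1 i j
  obtain ⟨a, ha⟩ := exists_integral_fundSol_mul_eq n hn
  set S := ∑ i, ∑ j, K i j with hS
  have hKS : ∀ i j, K i j ≤ S := fun i j =>
    (Finset.single_le_sum (fun j _ => hK0 i j) (Finset.mem_univ j)).trans
      (Finset.single_le_sum (f := fun i => ∑ j, K i j)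
        (fun i _ => Finset.sum_nonneg fun j _ => hK0 i j) (Finset.mem_univ i))
  have hS0 : 0 ≤ S := Finset.sum_nonneg fun i _ => Finset.sum_nonneg fun j _ => hK0 i j
  have hα0 := hα.1
  have hα1 : 0 < 1 - α := sub_pos.2 hα.2
  refine ⟨|a| * S * (α⁻¹ + (1 - α)⁻¹) + 1, by positivity, ?_⟩
  intro g hg hgc H hgH i j x y
  rcases eq_or_ne x y with rfl | hxy
  · simp [Real.zero_rpow hα0.ne']
  have hδ : 0 < ‖x - y‖ := norm_sub_pos_iff.2 hxy
  have hH : 0 ≤ H := nonneg_of_mul_nonneg_left ((abs_nonneg _).trans (hgH x y))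
    (Real.rpow_pos_of_pos hδ α)
  change |secondPartial _ i j x - secondPartial _ i j y| ≤ _
  rw [secondPartial_newtonian_potential hn hg hgc, secondPartial_newtonian_potential hn hg hgc]
  have hG := (contDiff_secondPartial hg i j).continuous
  have hGc := hasCompactSupport_secondPartial hgc i j
  have hcont : ∀ z : En n, Continuous fun v => secondPartial g i j (z - v) := fun z =>
    hG.comp (continuous_const.sub continuous_id)
  have hcs : ∀ z : En n, HasCompactSupport fun v => secondPartial g i j (z - v) := fun z =>
    hGc.comp_homeomorph (Homeomorph.subLeft z)
  have hzero : ∀ z : En n, ∫ v, secondPartial g i j (z - v) = 0 := fun z => by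
    rw [integral_sub_left_eq_self _ volume z]
    exact integral_fderiv_eq_zero (contDiff_fderiv_const hg _) (hgc.fderiv_apply ℝ _) _
  have hprod : ∀ {f : En n → ℝ}, LocallyIntegrable f → ∀ z : En n,
      Integrable fun v => f v * secondPartial g i j (z - v) := fun hf z => by
    simpa only [smul_eq_mul, mul_comm] using
      hf.integrable_smul_left_of_hasCompactSupport (hcont z) (hcs z)
  have hE := locallyIntegrable_fundSol n hn
  obtain ⟨R, hR⟩ := ha (fun v => secondPartial g i j (x - v) - secondPartial g i j (y - v))
    ((hcont x).sub (hcont y)) ((hcs x).sub (hcs y)) (by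
      rw [integral_sub ((hcont x).integrable_of_hasCompactSupport (hcs x))
        ((hcont y).integrable_of_hasCompactSupport (hcs y)), hzero, hzero, sub_zero])
  rw [← integral_sub (hprod hE x) (hprod hE y)]
  simp only [← mul_sub]
  rw [hR, abs_mul]
  obtain ⟨hBi, hB⟩ := integral_scaleBound hα hδ
  have hbound : |∫ t in Ioc 0 R, ∫ v, scaleKernel n t v *
      (secondPartial g i j (x - v) - secondPartial g i j (y - v))|
      ≤ ∫ t in Ioc 0 R, S * H * scaleBound α ‖x - y‖ t := by
    rw [← Real.norm_eq_abs]
    refine norm_integral_le_of_norm_le ((hBi.mono_set Ioc_subset_Ioi_self).const_mul _)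
      ((ae_restrict_iff' measurableSet_Ioc).2 (.of_forall fun t ht => ?_))
    have hk : LocallyIntegrable (scaleKernel n t) :=
      ((continuous_const.mul ((contDiff_cutoff n).continuous.comp
        (continuous_const_smul t⁻¹)))).locallyIntegrable
    simp only [mul_sub]
    rw [integral_sub (hprod hk x) (hprod hk y)]
    refine (hK i j g hg H hH hgH x y t ht.1).trans ?_
    have := scaleBound_nonneg (α := α) hδ ht.1.le
    gcongr
    exact hKS i j
  have hmono : ∫ t in Ioc 0 R, scaleBound α ‖x - y‖ t
      ≤ ∫ t in Ioi 0, scaleBound α ‖x - y‖ t :=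
    setIntegral_mono_set hBi ((ae_restrict_iff' measurableSet_Ioi).2
      (.of_forall fun t ht => scaleBound_nonneg hδ (le_of_lt ht)))
      Ioc_subset_Ioi_self.eventuallyLE
  rw [integral_const_mul] at hbound
  calc _ ≤ |a| * (S * H * ((α⁻¹ + (1 - α)⁻¹) * ‖x - y‖ ^ α)) := by
        rw [hB] at hmono
        gcongr
        exact hbound.trans (by gcongr)
    _ ≤ _ := by
        have : 0 ≤ H * ‖x - y‖ ^ α := by positivity
        linarith
end
end

section
/- Let n ≥ 1 and let Ω ⊂ ℝⁿ be a bounded open set with 0 ∈ Ω such that λ • (closure of Ω) ⊆ Ω for every λ ∈ (0,1). Let f : ℝⁿ → ℝ be continuously differentiable with support contained in the closure of Ω and with f = 0 and ∇f = 0 at every point of ∂Ω. Then there exists a sequence (f_m) of smooth functions with compact support contained in Ω such that sup_{ℝⁿ} |f − f_m| + sup_{ℝⁿ} |∇f − ∇f_m| → 0 as m → ∞. -/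
open MeasureTheory Set Metric Filter Pointwise

noncomputable section

open scoped Convolution Topology

/-- The derivative of a mollification is the mollification of the derivative. -/
theorem ContDiffBump.fderiv_normed_convolution {E F : Type*} [NormedAddCommGroup E]
    [NormedSpace ℝ E] [FiniteDimensional ℝ E] [MeasurableSpace E] [BorelSpace E]
    [NormedAddCommGroup F] [NormedSpace ℝ F] (φ : ContDiffBump (0 : E)) (μ : Measure E)
    [μ.IsAddHaarMeasure] {g : E → F} (hg : ContDiff ℝ 1 g) (hgc : HasCompactSupport g) (x : E) :
    fderiv ℝ (φ.normed μ ⋆[ContinuousLinearMap.lsmul ℝ ℝ, μ] g) x =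
      (φ.normed μ ⋆[ContinuousLinearMap.lsmul ℝ ℝ, μ] fderiv ℝ g) x :=
  (hgc.hasFDerivAt_convolution_right (ContinuousLinearMap.lsmul ℝ ℝ)
    φ.continuous_normed.locallyIntegrable hg x).fderiv

/-- A compactly supported `C¹` function with support in an open set `U` is a `C¹`-uniform limit of
smooth functions with compact support in `U`. -/
theorem HasCompactSupport.exists_smooth_tsupport_subset_fderiv_approx {E F : Type*} [NormedAddCommGroup E]
    [NormedSpace ℝ E] [FiniteDimensional ℝ E] [NormedAddCommGroup F] [NormedSpace ℝ F]
    [CompleteSpace F] {g : E → F} {U : Set E} (hgc : HasCompactSupport g) (hg : ContDiff ℝ 1 g)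
    (hU : IsOpen U) (hgU : tsupport g ⊆ U) {ε : ℝ} (hε : 0 < ε) :
    ∃ G : E → F, ContDiff ℝ (⊤ : ℕ∞) G ∧ HasCompactSupport G ∧ tsupport G ⊆ U ∧
      ∀ x, dist (G x) (g x) ≤ ε ∧ dist (fderiv ℝ G x) (fderiv ℝ g x) ≤ ε := by
  borelize E
  let μ : Measure E := Measure.addHaar
  have hg' : Continuous (fderiv ℝ g) := hg.continuous_fderiv one_ne_zero
  obtain ⟨δ₀, hδ₀, hsub⟩ := IsCompact.exists_cthickening_subset_open hgc hU hgU
  obtain ⟨δ₁, hδ₁, h₁⟩ := Metric.uniformContinuous_iff.1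
    (hgc.uniformContinuous_of_continuous hg.continuous) ε hε
  obtain ⟨δ₂, hδ₂, h₂⟩ := Metric.uniformContinuous_iff.1
    ((hgc.fderiv ℝ).uniformContinuous_of_continuous hg') ε hε
  obtain ⟨δ, hδ, hlt⟩ := exists_between (lt_min hδ₀ (lt_min hδ₁ hδ₂))
  obtain ⟨hlt₀, hlt₁, hlt₂⟩ : δ < δ₀ ∧ δ < δ₁ ∧ δ < δ₂ := by simpa using hlt
  let φ : ContDiffBump (0 : E) := ⟨δ / 2, δ, half_pos hδ, half_lt_self hδ⟩
  let G : E → F := φ.normed μ ⋆[ContinuousLinearMap.lsmul ℝ ℝ, μ] g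
  have hsupp : tsupport G ⊆ cthickening δ₀ (tsupport g) := by
    refine closure_minimal ?_ isClosed_cthickening
    refine (support_convolution_subset (ContinuousLinearMap.lsmul ℝ ℝ)).trans ?_
    rintro _ ⟨a, ha, b, hb, rfl⟩
    rw [φ.support_normed_eq, mem_ball_zero_iff] at ha
    refine mem_cthickening_of_dist_le _ b _ _ (subset_tsupport g hb) ?_
    simpa using (ha.trans hlt₀).le
  refine ⟨G, φ.hasCompactSupport_normed.contDiff_convolution_left _ φ.contDiff_normed
    hg.continuous.locallyIntegrable, ?_, hsupp.trans hsub, fun x => ⟨?_, ?_⟩⟩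
  · exact IsCompact.of_isClosed_subset (IsCompact.cthickening hgc) (isClosed_tsupport G) hsupp
  · exact φ.dist_normed_convolution_le hg.continuous.aestronglyMeasurable
      fun y hy => (h₁ ((mem_ball.1 hy).trans hlt₁)).le
  · rw [φ.fderiv_normed_convolution μ hg hgc]
    exact φ.dist_normed_convolution_le hg'.aestronglyMeasurable
      fun y hy => (h₂ ((mem_ball.1 hy).trans hlt₂)).le

/-- The dilations of a compactly supported `C¹` function by factors `s ↓ 1` converge to it uniformly
together with their derivatives. -/
theorem HasCompactSupport.eventually_dist_comp_smul_le {E F : Type*} [NormedAddCommGroup E]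
    [NormedSpace ℝ E] [ProperSpace E] [NormedAddCommGroup F] [NormedSpace ℝ F] {f : E → F}
    (hfc : HasCompactSupport f) (hf : ContDiff ℝ 1 f) {ε : ℝ} (hε : 0 < ε) :
    ∀ᶠ s in 𝓝[>] (1 : ℝ), ∀ x, dist (f (s • x)) (f x) ≤ ε ∧
      dist (fderiv ℝ (fun y => f (s • y)) x) (fderiv ℝ f x) ≤ ε := by
  have hf' : Continuous (fderiv ℝ f) := hf.continuous_fderiv one_ne_zero
  obtain ⟨R, hR⟩ := hfc.isBounded.subset_closedBall (0 : E)
  have hnear : ∀ᶠ s in 𝓝 (1 : ℝ), ∀ x ∈ closedBall (0 : E) R,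
      dist (f (s • x)) (f x) < ε ∧ dist (s • fderiv ℝ f (s • x)) (fderiv ℝ f x) < ε := by
    refine (isCompact_closedBall (0 : E) R).eventually_forall_of_forall_eventually fun x _ => ?_
    have hc₀ : Continuous fun p : ℝ × E => dist (f (p.1 • p.2)) (f p.2) := by
      have := hf.continuous
      fun_prop
    have hc₁ : Continuous fun p : ℝ × E =>
        dist (p.1 • fderiv ℝ f (p.1 • p.2)) (fderiv ℝ f p.2) := by
      fun_prop
    exact (hc₀.continuousAt.eventually_lt_const (by simpa using hε)).and
      (hc₁.continuousAt.eventually_lt_const (by simpa using hε))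
  filter_upwards [nhdsWithin_le_nhds hnear, self_mem_nhdsWithin] with s hs hs1 x
  rw [fderiv_comp_smul]
  by_cases hx : x ∈ closedBall (0 : E) R
  · exact ⟨(hs x hx).1.le, (hs x hx).2.le⟩
  · have hsx : s • x ∉ closedBall (0 : E) R := by
      simp only [mem_closedBall_zero_iff, not_le, norm_smul] at hx ⊢
      have h1 : 1 < ‖s‖ := hs1.out.trans_le (Real.le_norm_self s)
      nlinarith [norm_nonneg x]
    have hz : ∀ y ∉ closedBall (0 : E) R, f y = 0 ∧ fderiv ℝ f y = 0 := fun y hy =>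
      ⟨image_eq_zero_of_notMem_tsupport fun h => hy (hR h),
        image_eq_zero_of_notMem_tsupport fun h => hy (hR (tsupport_fderiv_subset ℝ h))⟩
    simp [hz x hx, hz _ hsx, hε.le]

/-- The gradient is an isometric image of the Fréchet derivative. -/
theorem norm_gradient_sub_gradient {E : Type*} [NormedAddCommGroup E] [InnerProductSpace ℝ E]
    [CompleteSpace E] (f g : E → ℝ) (x : E) :
    ‖gradient f x - gradient g x‖ = dist (fderiv ℝ g x) (fderiv ℝ f x) := by
  rw [gradient, gradient, ← dist_eq_norm, LinearIsometryEquiv.dist_map, dist_comm]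

/-- The star-shaped case at the core of Proposition 6.4 (i): a `C¹` function
supported in the closure of a bounded star-shaped open set, vanishing together with
its gradient on the boundary, is a `W^{1,∞}`-limit of smooth compactly supported
functions. -/
theorem starshaped_W1inf_approximation
    (n : ℕ) (hn : 1 ≤ n) (Ω : Set (En n)) (hΩo : IsOpen Ω)
    (hΩb : Bornology.IsBounded Ω) (h0 : (0 : En n) ∈ Ω)
    (hstar : ∀ lam : ℝ, lam ∈ Ioo (0 : ℝ) 1 → lam • closure Ω ⊆ Ω)
    (f : En n → ℝ) (hf : ContDiff ℝ 1 f) (hsupp : tsupport f ⊆ closure Ω)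
    (hbd : ∀ x ∈ frontier Ω, f x = 0 ∧ gradient f x = 0) :
    ∃ F : ℕ → En n → ℝ,
      (∀ m, ContDiff ℝ (⊤ : ℕ∞) (F m) ∧ HasCompactSupport (F m) ∧ tsupport (F m) ⊆ Ω) ∧
      ∀ ε : ℝ, 0 < ε → ∃ M : ℕ, ∀ m ≥ M, ∀ x : En n,
        |f x - F m x| + ‖gradient f x - gradient (F m) x‖ ≤ ε := by
  have hfc : HasCompactSupport f :=
    hΩb.isCompact_closure.of_isClosed_subset (isClosed_tsupport f) hsupp
  have key : ∀ ε : ℝ, 0 < ε → ∃ G : En n → ℝ,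
      (ContDiff ℝ (⊤ : ℕ∞) G ∧ HasCompactSupport G ∧ tsupport G ⊆ Ω) ∧
      ∀ x, |f x - G x| + ‖gradient f x - gradient G x‖ ≤ ε := by
    intro ε hε
    have hε4 : 0 < ε / 4 := by positivity
    obtain ⟨s, hs, hs1⟩ :=
      ((hfc.eventually_dist_comp_smul_le hf hε4).and self_mem_nhdsWithin).exists
    replace hs1 : 1 < s := hs1
    have hs0 : s ≠ 0 := by positivity
    have htsupp : tsupport (fun x => f (s • x)) ⊆ Ω := by
      intro x hx
      have hsx : s • x ∈ tsupport f :=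
        tsupport_comp_subset_preimage f (continuous_const_smul s) hx
      refine hstar s⁻¹ ⟨by positivity, inv_lt_one_of_one_lt₀ hs1⟩ ?_
      exact ⟨s • x, hsupp hsx, inv_smul_smul₀ hs0 x⟩
    obtain ⟨G, hG, hGc, hGΩ, hGε⟩ :=
      HasCompactSupport.exists_smooth_tsupport_subset_fderiv_approx (g := fun x => f (s • x))
        (hfc.comp_smul hs0) (hf.comp (contDiff_const_smul s)) hΩo htsupp hε4
    refine ⟨G, ⟨hG, hGc, hGΩ⟩, fun x => ?_⟩
    rw [norm_gradient_sub_gradient, abs_sub_comm, ← Real.dist_eq]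
    have h₀ := dist_triangle (G x) (f (s • x)) (f x)
    have h₁ := dist_triangle (fderiv ℝ G x) (fderiv ℝ (fun y => f (s • y)) x) (fderiv ℝ f x)
    linarith [(hs x).1, (hs x).2, (hGε x).1, (hGε x).2]
  choose F hF hFε using fun m : ℕ => key (1 / (m + 1)) Nat.one_div_pos_of_nat
  refine ⟨F, hF, fun ε hε => ?_⟩
  obtain ⟨M, hM⟩ := exists_nat_one_div_lt hε
  exact ⟨M, fun m hm x => (hFε m x).trans ((Nat.one_div_le_one_div hm).trans hM.le)⟩
end
end
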